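/- There exists a nonseparable real Banach space 𝔛 such that: (1) 𝔛 is c₀-saturated, i.e., every infinite-dimensional closed linear subspace of 𝔛 contains a closed linear subspace isomorphic (as a topological vector space, via a bounded linear isomorphism) to c₀; and (2) for every closed linear subspace X of 𝔛 and every decomposition X = X₀ ⊕ X₁ of X as a topological direct sum of two closed linear subspaces X₀ and X₁, at least one of X₀, X₁ is separable. -/

import Mathlib

open Set Topology

/-- `c₀`: the Banach space of real sequences converging to `0`, with the sup norm
(realized in Mathlib as the continuous functions `ℕ → ℝ` vanishing at infinity). -/
abbrev czero : Type := ZeroAtInftyContinuousMap ℕ ℝ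

/-- A witness for a nonseparable Banach space `X` which is `c₀`-saturated and such that
in every topological direct sum decomposition of a closed subspace of `X` one of the
summands is separable. -/
structure LopezAbadTodorcevicSpace : Type 1 where
  X : Type
  [ng : NormedAddCommGroup X]
  [ns : NormedSpace ℝ X]
  complete : CompleteSpace X
  nonseparable : ¬ TopologicalSpace.SeparableSpace X
  /-- `X` is `c₀`-saturated: every infinite-dimensional closed subspace contains a closed
  subspace isomorphic to `c₀` via a continuous linear equivalence. -/
  c0_saturated : ∀ Y : Submodule ℝ X, IsClosed (Y : Set X) → ¬ FiniteDimensional ℝ Y →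
    ∃ Z : Submodule ℝ X, Z ≤ Y ∧ IsClosed (Z : Set X) ∧ Nonempty (Z ≃L[ℝ] czero)
  /-- For every topological direct sum decomposition `Y = X₀ ⊕ X₁` of a closed subspace
  `Y` into closed subspaces, `X₀` or `X₁` is separable. -/
  decomposition_separable : ∀ Y X₀ X₁ : Submodule ℝ X,
    IsClosed (Y : Set X) → IsClosed ((X₀ : Set X)) → IsClosed ((X₁ : Set X)) →
    X₀ ≤ Y → X₁ ≤ Y → X₀ ⊓ X₁ = ⊥ → X₀ ⊔ X₁ = Y →
    TopologicalSpace.IsSeparable (X₀ : Set X) ∨ TopologicalSpace.IsSeparable (X₁ : Set X)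

namespace LopezAbadTodorcevic

/-- A coherent system of finite balls on a linear order: `ξ ∈ B n α` is to be read as
`ξ ≤ α` and `ρ ξ α ≤ n` for an ordinal metric `ρ`. -/
structure BallSystem (Γ : Type) [LinearOrder Γ] where
  /-- the ball of radius `n` below `α` -/
  B : ℕ → Γ → Finset Γ
  le_of_mem : ∀ {n α ξ}, ξ ∈ B n α → ξ ≤ α
  self_mem : ∀ n α, α ∈ B n α
  mono : ∀ {n n' : ℕ} α, n ≤ n' → B n α ⊆ B n' α
  exists_mem : ∀ {ξ α}, ξ ≤ α → ∃ n, ξ ∈ B n α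
  coherent : ∀ {n α ξ}, ξ ∈ B n α → ∀ ζ, ζ ∈ B n ξ ↔ ζ ∈ B n α ∧ ζ ≤ ξ

section Existence

variable {Γ : Type} [LinearOrder Γ]

/-- `F` extends the coherent system `prev` of balls strictly below `α` to `α`. -/
def IsBallExtension (α : Γ) (prev : ∀ ξ : Γ, ξ < α → ℕ → Finset Γ) (F : ℕ → Finset Γ) : Prop :=
  (∀ n, ∀ ξ ∈ F n, ξ < α) ∧ Monotone F ∧ (∀ ξ < α, ∃ n, ξ ∈ F n) ∧
    ∀ n ξ (h : ξ < α), ξ ∈ F n → ∀ ζ, ζ ∈ prev ξ h n ↔ ζ ∈ F n ∧ ζ ≤ ξ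

theorem exists_isBallExtension (hc : ∀ a : Γ, (Iio a).Countable) (α : Γ)
    (B : Γ → ℕ → Finset Γ)
    (h1 : ∀ ξ < α, ∀ n, ∀ ζ ∈ B ξ n, ζ ≤ ξ) (h2 : ∀ ξ < α, ∀ n, ξ ∈ B ξ n)
    (h3 : ∀ ξ < α, Monotone (B ξ)) (h4 : ∀ ξ < α, ∀ ζ ≤ ξ, ∃ n, ζ ∈ B ξ n)
    (h5 : ∀ ξ < α, ∀ n, ∀ η ∈ B ξ n, ∀ ζ, ζ ∈ B η n ↔ ζ ∈ B ξ n ∧ ζ ≤ η) :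
    ∃ F, IsBallExtension α (fun ξ _ => B ξ) F := by
  classical
  rcases (Iio α).eq_empty_or_nonempty with he | hne
  · have hno : ∀ ξ : Γ, ¬ ξ < α := fun ξ hξ => by
      have : ξ ∈ Iio α := hξ
      simp [he] at this
    refine ⟨fun _ => ∅, by simp, fun _ _ _ => le_rfl, fun ξ hξ => (hno ξ hξ).elim, by simp⟩
  · obtain ⟨e, he⟩ := (hc α).exists_eq_range hne
    have hea : ∀ k, e k < α := fun k => by
      have : e k ∈ Iio α := he ▸ mem_range_self k
      exact this
    set a : ℕ → Γ := fun k => partialSups e k with ha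
    have hmono : Monotone a := (partialSups e).monotone
    have haα : ∀ k, a k < α := by
      intro k
      induction k with
      | zero => simpa [ha] using hea 0
      | succ k ih =>
        simp only [ha, partialSups_add_one]
        exact max_lt ih (hea _)
    set P : ℕ → ℕ → Prop := fun n k => ∀ i i', i ≤ i' → i' ≤ k → a i ∈ B (a i') n with hP
    have hP0 : ∀ n, P n 0 := by
      intro n i i' h h'
      obtain rfl : i' = 0 := by omega
      obtain rfl : i = 0 := by omega
      exact h2 _ (haα 0) n
    set kk : ℕ → ℕ := fun n => Nat.findGreatest (P n) n with hkk
    have hkkP : ∀ n, P n (kk n) := fun n => Nat.findGreatest_spec (Nat.zero_le n) (hP0 n)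
    have hkkle : ∀ n, kk n ≤ n := fun n => Nat.findGreatest_le n
    have hlekk : ∀ n k, k ≤ n → P n k → k ≤ kk n := fun n k h h' => Nat.le_findGreatest h h'
    have hsub : ∀ n k, k ≤ kk n → B (a k) n ⊆ B (a (kk n)) n := by
      intro n k hk ζ hζ
      exact ((h5 _ (haα _) n (a k) (hkkP n k (kk n) hk le_rfl) ζ).1 hζ).1
    refine ⟨fun n => B (a (kk n)) n, fun n ξ hξ => (h1 _ (haα _) n ξ hξ).trans_lt (haα _),
      ?_, ?_, ?_⟩
    · intro n n' hn
      have : kk n ≤ kk n' := hlekk _ _ ((hkkle n).trans hn)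
        fun i i' h h' => h3 _ (haα _) hn (hkkP n i i' h h')
      exact (h3 _ (haα _) hn).trans (hsub n' (kk n) this)
    · intro ξ hξ
      obtain ⟨k, rfl⟩ : ∃ k, e k = ξ := by
        have : ξ ∈ range e := he ▸ hξ
        exact this
      have hek : e k ≤ a k := le_partialSups e k
      obtain ⟨n0, hn0⟩ := h4 _ (haα k) _ hek
      have hex : ∀ i i', ∃ n, i ≤ i' → a i ∈ B (a i') n := by
        intro i i'
        by_cases h : i ≤ i'
        · obtain ⟨n, hn⟩ := h4 _ (haα i') _ (hmono h)
          exact ⟨n, fun _ => hn⟩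
        · exact ⟨0, fun h' => (h h').elim⟩
      choose g hg using hex
      set n := max (max n0 k)
        ((Finset.range (k + 1)).sup fun i => (Finset.range (k + 1)).sup fun i' => g i i')
        with hn
      have hgn : ∀ i i', i ≤ i' → i' ≤ k → g i i' ≤ n := by
        intro i i' h h'
        refine le_trans ?_ (le_max_right _ _)
        refine le_trans ?_ (Finset.le_sup
          (f := fun i => (Finset.range (k + 1)).sup fun i' => g i i')
          (Finset.mem_range.2 (by omega : i < k + 1)))
        exact Finset.le_sup (f := fun i' => g i i') (Finset.mem_range.2 (by omega : i' < k + 1))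
      have hkn : k ≤ n := (le_max_right _ _).trans (le_max_left _ _)
      have hn0n : n0 ≤ n := (le_max_left _ _).trans (le_max_left _ _)
      refine ⟨n, hsub n k (hlekk n k hkn fun i i' h h' => ?_) (h3 _ (haα k) hn0n hn0)⟩
      exact h3 _ (haα _) (hgn i i' h h') (hg i i' h)
    · intro n ξ h hξ ζ
      exact h5 _ (haα _) n ξ hξ ζ

open scoped Classical in
/-- The balls, by well-founded recursion. -/
noncomputable def ballFun [WellFoundedLT Γ] : Γ → ℕ → Finset Γ :=
  (wellFounded_lt (α := Γ)).fix fun α prev n =>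
    insert α (if h : ∃ F, IsBallExtension α prev F then h.choose n else ∅)

theorem exists_ballFun_eq [WellFoundedLT Γ] (hc : ∀ a : Γ, (Iio a).Countable) (α : Γ) :
    ∃ F, IsBallExtension α (fun ξ _ => ballFun ξ) F ∧
      ∀ n ζ, ζ ∈ ballFun α n ↔ ζ = α ∨ ζ ∈ F n := by
  classical
  induction α using WellFoundedLT.induction with
  | ind α ih =>
    have hex : ∃ F, IsBallExtension α (fun ξ _ => ballFun ξ) F := by
      refine exists_isBallExtension hc α ballFun ?_ ?_ ?_ ?_ ?_
      · intro ξ hξ n ζ hζ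
        obtain ⟨F, ⟨f1, f2, f3, f4⟩, hF⟩ := ih ξ hξ
        rcases (hF n ζ).1 hζ with rfl | h
        · exact le_rfl
        · exact (f1 n ζ h).le
      · intro ξ hξ n
        obtain ⟨F, ⟨f1, f2, f3, f4⟩, hF⟩ := ih ξ hξ
        exact (hF n ξ).2 (Or.inl rfl)
      · intro ξ hξ n n' hn ζ hζ
        obtain ⟨F, ⟨f1, f2, f3, f4⟩, hF⟩ := ih ξ hξ
        exact (hF n' ζ).2 (((hF n ζ).1 hζ).imp id fun h => f2 hn h)
      · intro ξ hξ ζ hζ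
        obtain ⟨F, ⟨f1, f2, f3, f4⟩, hF⟩ := ih ξ hξ
        rcases hζ.eq_or_lt with rfl | h
        · exact ⟨0, (hF 0 ζ).2 (Or.inl rfl)⟩
        · obtain ⟨n, hn⟩ := f3 ζ h
          exact ⟨n, (hF n ζ).2 (Or.inr hn)⟩
      · intro ξ hξ n η hη ζ
        obtain ⟨F, ⟨f1, f2, f3, f4⟩, hF⟩ := ih ξ hξ
        rcases (hF n η).1 hη with rfl | h
        · constructor
          · intro hζ
            refine ⟨hζ, ?_⟩
            rcases (hF n ζ).1 hζ with rfl | h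
            · exact le_rfl
            · exact (f1 n ζ h).le
          · exact fun h => h.1
        · have hlt := f1 n η h
          rw [f4 n η hlt h ζ, hF]
          constructor
          · rintro ⟨h1, h2⟩
            exact ⟨Or.inr h1, h2⟩
          · rintro ⟨rfl | h1, h2⟩
            · exact absurd hlt (not_lt.2 h2)
            · exact ⟨h1, h2⟩
    refine ⟨hex.choose, hex.choose_spec, fun n ζ => ?_⟩
    have : ballFun α n = insert α (hex.choose n) := by
      have h := congrFun ((wellFounded_lt (α := Γ)).fix_eq (fun α prev n =>
        insert α (if h : ∃ F, IsBallExtension α prev F then h.choose n else ∅)) α) n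
      refine (h.trans ?_ : _)
      exact congrArg (insert α) (dif_pos hex ▸ rfl)
    rw [this, Finset.mem_insert]

/-- A well-order all of whose proper initial segments are countable carries a coherent system of
finite balls. -/
theorem nonempty_ballSystem [WellFoundedLT Γ] (hc : ∀ a : Γ, (Iio a).Countable) :
    Nonempty (BallSystem Γ) := by
  choose F hF hmem using exists_ballFun_eq hc
  refine ⟨⟨fun n α => ballFun α n, ?_, ?_, ?_, ?_, ?_⟩⟩
  · intro n α ξ hξ
    rcases (hmem α n ξ).1 hξ with rfl | h
    · exact le_rfl
    · exact ((hF α).1 n ξ h).le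
  · intro n α
    exact (hmem α n α).2 (Or.inl rfl)
  · intro n n' α hn ζ hζ
    exact (hmem α n' ζ).2 (((hmem α n ζ).1 hζ).imp id fun h => (hF α).2.1 hn h)
  · intro ζ ξ hζ
    rcases hζ.eq_or_lt with rfl | h
    · exact ⟨0, (hmem ζ 0 ζ).2 (Or.inl rfl)⟩
    · obtain ⟨n, hn⟩ := (hF ξ).2.2.1 ζ h
      exact ⟨n, (hmem ξ n ζ).2 (Or.inr hn)⟩
  · intro n ξ η hη ζ
    rcases (hmem ξ n η).1 hη with rfl | h
    · constructor
      · intro hζ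
        refine ⟨hζ, ?_⟩
        rcases (hmem η n ζ).1 hζ with rfl | h
        · exact le_rfl
        · exact ((hF η).1 n ζ h).le
      · exact fun h => h.1
    · have hlt := (hF ξ).1 n η h
      rw [(hF ξ).2.2.2 n η hlt h ζ, hmem]
      constructor
      · rintro ⟨h1, h2⟩
        exact ⟨Or.inr h1, h2⟩
      · rintro ⟨rfl | h1, h2⟩
        · exact absurd hlt (not_lt.2 h2)
        · exact ⟨h1, h2⟩

end Existence

/-! ### The index set -/

/-- The first uncountable ordinal, as a well-ordered type. -/
abbrev Idx : Type := (Cardinal.aleph 1).ord.ToType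

theorem countable_Iio_idx (a : Idx) : (Iio a).Countable := by
  have h := Cardinal.mk_Iio_lt a (by simp)
  rw [Cardinal.mk_ord_toType, Cardinal.lt_aleph_one_iff] at h
  exact Cardinal.le_aleph0_iff_set_countable.1 h

instance uncountable_idx : Uncountable Idx := by
  rw [← Cardinal.aleph0_lt_mk_iff, Cardinal.mk_ord_toType]
  exact Cardinal.aleph0_lt_aleph_one

theorem exists_forall_lt {S : Set Idx} (hS : S.Countable) : ∃ γ, ∀ ξ ∈ S, ξ < γ := by
  have hc : (⋃ ξ ∈ S, Iic ξ).Countable := hS.biUnion fun ξ _ => by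
    rw [← Iio_insert]
    exact (countable_Iio_idx ξ).insert ξ
  have hne : (⋃ ξ ∈ S, Iic ξ) ≠ univ := fun h => Set.not_countable_univ (h ▸ hc)
  obtain ⟨γ, hγ⟩ := (ne_univ_iff_exists_notMem _).1 hne
  refine ⟨γ, fun ξ hξ => not_le.1 fun h => hγ ?_⟩
  exact mem_biUnion hξ h

instance noMaxOrder_idx : NoMaxOrder Idx :=
  ⟨fun a => by
    obtain ⟨γ, hγ⟩ := exists_forall_lt (countable_singleton a)
    exact ⟨γ, hγ a rfl⟩⟩

theorem exists_not_lt_of_uncountable {A : Set Idx} (hA : ¬ A.Countable) (γ : Idx) :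
    ∃ α ∈ A, γ ≤ α := by
  by_contra! h
  exact hA ((countable_Iio_idx γ).mono h)

/-- A fixed coherent system of finite balls on the index set. -/
noncomputable def balls : BallSystem Idx := (nonempty_ballSystem countable_Iio_idx).some

/-- The ball of radius `n` below `α`. -/
noncomputable def ball (n : ℕ) (α : Idx) : Finset Idx := balls.B n α

theorem le_of_mem_ball {n : ℕ} {α ξ : Idx} (h : ξ ∈ ball n α) : ξ ≤ α := balls.le_of_mem h

theorem self_mem_ball (n : ℕ) (α : Idx) : α ∈ ball n α := balls.self_mem n α

theorem ball_mono {n n' : ℕ} (α : Idx) (h : n ≤ n') : ball n α ⊆ ball n' α := balls.mono α h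

theorem exists_mem_ball {ξ α : Idx} (h : ξ ≤ α) : ∃ n, ξ ∈ ball n α := balls.exists_mem h

theorem mem_ball_iff {n : ℕ} {α ξ : Idx} (h : ξ ∈ ball n α) {ζ : Idx} :
    ζ ∈ ball n ξ ↔ ζ ∈ ball n α ∧ ζ ≤ ξ := balls.coherent h ζ

theorem mem_ball_trans {n : ℕ} {α ξ ζ : Idx} (h : ζ ∈ ball n ξ) (h' : ξ ∈ ball n α) :
    ζ ∈ ball n α := ((mem_ball_iff h').1 h).1

theorem mem_ball_of_mem_ball {n : ℕ} {α ξ ζ : Idx} (h : ζ ∈ ball n α) (h' : ξ ∈ ball n α)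
    (hle : ζ ≤ ξ) : ζ ∈ ball n ξ := (mem_ball_iff h').2 ⟨h, hle⟩

/-- The cardinality of the ball of radius `n`. -/
noncomputable def height (n : ℕ) (α : Idx) : ℕ := (ball n α).card

theorem height_lt_height {n : ℕ} {ξ α : Idx} (h : ξ ∈ ball n α) (hne : ξ < α) :
    height n ξ < height n α := by
  apply Finset.card_lt_card
  refine ⟨fun ζ hζ => mem_ball_trans hζ h, fun hsub => ?_⟩
  exact absurd (le_of_mem_ball (hsub (self_mem_ball n α))) (not_le.2 hne)

/-- Any two elements of `S` are at distance at most `n`. -/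
def IsClose (n : ℕ) (S : Set Idx) : Prop := ∀ ξ ∈ S, ∀ η ∈ S, ξ ≤ η → ξ ∈ ball n η

theorem IsClose.mono {n : ℕ} {S T : Set Idx} (h : IsClose n T) (hST : S ⊆ T) : IsClose n S :=
  fun ξ hξ η hη => h ξ (hST hξ) η (hST hη)

theorem IsClose.mono_radius {n n' : ℕ} {S : Set Idx} (h : IsClose n S) (hn : n ≤ n') :
    IsClose n' S :=
  fun ξ hξ η hη hle => ball_mono _ hn (h ξ hξ η hη hle)

theorem exists_isClose {S : Set Idx} (hS : S.Finite) : ∃ n, IsClose n S := by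
  classical
  have : ∀ ξ η : Idx, ∃ n, ξ ≤ η → ξ ∈ ball n η := fun ξ η => by
    by_cases h : ξ ≤ η
    · obtain ⟨n, hn⟩ := exists_mem_ball h
      exact ⟨n, fun _ => hn⟩
    · exact ⟨0, fun h' => (h h').elim⟩
  choose f hf using this
  obtain ⟨n, hn⟩ := ((hS.prod hS).image fun q => f q.1 q.2).bddAbove
  refine ⟨n, fun ξ hξ η hη hle => ball_mono _ (hn ?_) (hf ξ η hle)⟩
  exact ⟨(ξ, η), ⟨hξ, hη⟩, rfl⟩

theorem IsClose.eq_of_height_eq {n : ℕ} {S : Set Idx} (h : IsClose n S) {ξ η : Idx} (hξ : ξ ∈ S)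
    (hη : η ∈ S) (he : height n ξ = height n η) : ξ = η := by
  rcases lt_trichotomy ξ η with hlt | rfl | hlt
  · exact absurd he (height_lt_height (h ξ hξ η hη hlt.le) hlt).ne
  · rfl
  · exact absurd he (height_lt_height (h η hη ξ hξ hlt.le) hlt).ne'

/-- Let `ξ` belong to two sets `S`, `T` of diameter at most `n`. An element `η` of `S` below `ξ`
belongs to `T` as soon as its height is a height of an element of `T`. -/
theorem IsClose.mem_of_height_eq {n : ℕ} {S T : Set Idx} (hS : IsClose n S) (hT : IsClose n T)
    {ξ η ζ : Idx} (hξS : ξ ∈ S) (hξT : ξ ∈ T) (hη : η ∈ S) (hηξ : η < ξ) (hζ : ζ ∈ T)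
    (he : height n ζ = height n η) : ζ = η := by
  have h1 : η ∈ ball n ξ := hS η hη ξ hξS hηξ.le
  have h2 := height_lt_height h1 hηξ
  have h3 : ζ ∈ ball n ξ := by
    rcases le_or_gt ζ ξ with h | h
    · exact hT ζ hζ ξ hξT h
    · have := height_lt_height (hT ξ hξT ζ hζ h.le) h
      omega
  have hcl : IsClose n (ball n ξ : Set Idx) := fun a ha b hb hab => mem_ball_of_mem_ball ha hb hab
  exact hcl.eq_of_height_eq h3 h1 he

/-- Sets on which distances to the right dominate distances to the left. -/
def IsIncreasing (S : Set Idx) : Prop :=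
  ∀ α ∈ S, ∀ β ∈ S, ∀ γ ∈ S, α < β → β < γ → ∀ n, β ∈ ball n γ → α ∈ ball n β

theorem IsIncreasing.mono {S T : Set Idx} (h : IsIncreasing T) (hST : S ⊆ T) : IsIncreasing S :=
  fun _ hα _ hβ _ hγ => h _ (hST hα) _ (hST hβ) _ (hST hγ)

theorem isIncreasing_of_subsingleton {S : Set Idx} (h : S.Subsingleton) : IsIncreasing S :=
  fun _ hα _ hβ _ _ hlt => absurd (h hα hβ) hlt.ne

/-! ### Weights and codes -/

/-- The sequence of weights. -/
noncomputable def mw (j : ℕ) : ℝ := 2 ^ (j ^ 2)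

/-- The sequence of admissible cardinalities. -/
def nw (j : ℕ) : ℕ := 2 ^ (4 * j ^ 3)

theorem mw_zero : mw 0 = 1 := by simp [mw]

theorem nw_zero : nw 0 = 1 := by simp [nw]

theorem mw_pos (j : ℕ) : 0 < mw j := by unfold mw; positivity

theorem one_le_mw (j : ℕ) : 1 ≤ mw j := one_le_pow₀ (by norm_num)

theorem nw_pos (j : ℕ) : 0 < nw j := by unfold nw; positivity

theorem cast_nw (j : ℕ) : (nw j : ℝ) = 2 ^ (4 * j ^ 3) := by simp [nw]

theorem cast_nw_pos (j : ℕ) : (0 : ℝ) < nw j := by exact_mod_cast nw_pos j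

theorem inv_mw_le (p : ℕ) : (mw p)⁻¹ ≤ (1 / 2) ^ p := by
  rw [one_div, inv_pow]
  apply inv_anti₀ (by positivity)
  exact pow_le_pow_right₀ (by norm_num) (by nlinarith [Nat.le_self_pow (n := 2) (by norm_num) p])

theorem mw_div_nw_le (j : ℕ) : mw j / nw j ≤ (1 / 2) ^ j := by
  rw [one_div, inv_pow, div_le_iff₀ (cast_nw_pos j), ← div_eq_inv_mul,
    le_div_iff₀ (by positivity), cast_nw, mw, ← pow_add]
  apply pow_le_pow_right₀ (by norm_num)
  have h1 : j ≤ j ^ 3 := Nat.le_self_pow (by norm_num) j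
  have h2 : j ^ 2 ≤ j ^ 3 := by
    rcases Nat.eq_zero_or_pos j with rfl | h
    · simp
    · exact Nat.pow_le_pow_right h (by norm_num)
  omega

theorem min_nw_mul_le {j p : ℕ} (h : p ≠ j) :
    (min (nw j) (nw p) : ℝ) * mw j ≤ (1 / 2) ^ (j + p) * (nw j * mw p) := by
  rw [one_div, inv_pow, ← div_eq_inv_mul, le_div_iff₀ (by positivity)]
  rcases lt_or_gt_of_ne h with hlt | hlt
  · calc (min (nw j) (nw p) : ℝ) * mw j * 2 ^ (j + p) ≤ nw p * mw j * 2 ^ (j + p) := by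
          gcongr
          · exact (mw_pos j).le
          · exact min_le_right _ _
      _ = 2 ^ (4 * p ^ 3 + j ^ 2 + (j + p)) := by rw [cast_nw, mw]; ring
      _ ≤ 2 ^ (4 * j ^ 3 + p ^ 2) := by
          apply pow_le_pow_right₀ (by norm_num)
          obtain ⟨k, rfl⟩ : ∃ k, j = p + 1 + k := ⟨j - (p + 1), by omega⟩
          ring_nf
          nlinarith [sq_nonneg p, sq_nonneg k, Nat.zero_le (p * k), Nat.zero_le (p ^ 2 * k),
            Nat.zero_le (k ^ 2 * p), Nat.zero_le (k ^ 3)]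
      _ = nw j * mw p := by rw [cast_nw, mw]; ring
  · calc (min (nw j) (nw p) : ℝ) * mw j * 2 ^ (j + p) ≤ nw j * mw j * 2 ^ (j + p) := by
          gcongr
          · exact (mw_pos j).le
          · exact min_le_left _ _
      _ = nw j * 2 ^ (j ^ 2 + (j + p)) := by rw [mw]; ring
      _ ≤ nw j * 2 ^ (p ^ 2) := by
          gcongr
          · norm_num
          · nlinarith
      _ = nw j * mw p := by rw [mw]

/-- The coding function. -/
def code (π : ℕ) (L : List (ℕ × Finset ℕ)) : ℕ :=
  Nat.pair (Encodable.encode (π, L)) (1 + (L.map Prod.fst).sum)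

theorem code_inj {π π' : ℕ} {L L' : List (ℕ × Finset ℕ)} (h : code π L = code π' L') :
    π = π' ∧ L = L' := by
  have := Encodable.encode_injective (Nat.pair_eq_pair.1 h).1
  exact Prod.mk.inj this

theorem lt_code {π : ℕ} {L : List (ℕ × Finset ℕ)} {p : ℕ × Finset ℕ} (h : p ∈ L) :
    p.1 < code π L := by
  have h1 : p.1 ≤ (L.map Prod.fst).sum := List.le_sum_of_mem (List.mem_map_of_mem h)
  have h2 := Nat.right_le_pair (Encodable.encode (π, L)) (1 + (L.map Prod.fst).sum)
  unfold code
  omega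

/-- The history of a sequence of weighted sets, as seen through the heights of radius `π`. -/
noncomputable def history (π : ℕ) (p : ℕ → ℕ) (G : ℕ → Finset Idx) (k : ℕ) :
    List (ℕ × Finset ℕ) :=
  (List.range k).map fun s => (p s, (G s).image (height π))

theorem lt_code_history {π : ℕ} {p : ℕ → ℕ} {G : ℕ → Finset Idx} {k s : ℕ} (hs : s < k) :
    p s < code π (history π p G k) :=
  lt_code (p := (p s, (G s).image (height π)))
    (List.mem_map.2 ⟨s, List.mem_range.2 hs, rfl⟩)

theorem history_congr {π : ℕ} {p p' : ℕ → ℕ} {G G' : ℕ → Finset Idx} {k : ℕ}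
    (hp : ∀ s < k, p s = p' s) (hG : ∀ s < k, G s = G' s) :
    history π p G k = history π p' G' k := by
  apply List.map_congr_left
  intro s hs
  rw [hp s (List.mem_range.1 hs), hG s (List.mem_range.1 hs)]

theorem code_history_inj {π π' : ℕ} {p p' : ℕ → ℕ} {G G' : ℕ → Finset Idx} {k k' : ℕ}
    (h : code π (history π p G k) = code π' (history π' p' G' k')) :
    π = π' ∧ k = k' ∧ ∀ s < k, p s = p' s ∧
      (G s).image (height π) = (G' s).image (height π) := by
  obtain ⟨rfl, hL⟩ := code_inj h
  have hk : k = k' := by simpa [history] using congrArg List.length hL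
  subst hk
  refine ⟨rfl, rfl, fun s hs => ?_⟩
  have := List.map_inj_left.1 hL s (List.mem_range.2 hs)
  exact Prod.mk.inj this

/-! ### Special sequences and the associated functionals -/

/-- Special sequences of weighted finite sets. -/
structure Special where
  /-- the length -/
  len : ℕ
  /-- the weights -/
  wt : ℕ → ℕ
  /-- the sets -/
  set : ℕ → Finset Idx
  /-- the radii -/
  par : ℕ → ℕ
  len_le : len ≤ wt 0 + 1
  card_le : ∀ t < len, (set t).card ≤ nw (wt t)
  incr : IsIncreasing {ξ | ∃ t < len, ξ ∈ set t}
  close : ∀ t, t + 1 < len → IsClose (par t) {ξ | ∃ s ≤ t, ξ ∈ set s}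
  wt_succ : ∀ t, t + 1 < len → wt (t + 1) = code (par t) (history (par t) wt set (t + 1))

namespace Special

theorem wt_lt_wt (s : Special) {a b : ℕ} (hab : a < b) (hb : b < s.len) : s.wt a < s.wt b := by
  obtain ⟨t, rfl⟩ : ∃ t, b = t + 1 := ⟨b - 1, by omega⟩
  rw [s.wt_succ t hb]
  exact lt_code_history hab

theorem wt_inj (s : Special) {a b : ℕ} (ha : a < s.len) (hb : b < s.len)
    (h : s.wt a = s.wt b) : a = b := by
  rcases lt_trichotomy a b with hlt | rfl | hlt
  · exact absurd h (s.wt_lt_wt hlt hb).ne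
  · rfl
  · exact absurd h (s.wt_lt_wt hlt ha).ne'

theorem wt_zero_add_le (s : Special) {t : ℕ} (ht : t < s.len) : s.wt 0 + t ≤ s.wt t := by
  induction t with
  | zero => simp
  | succ t ih =>
    have := ih (by omega)
    have := s.wt_lt_wt (Nat.lt_add_one t) ht
    omega

/-- The functional given by the `t`-th set. -/
noncomputable def term (s : Special) (γ : Idx) (t : ℕ) (c : Idx → ℝ) : ℝ :=
  (mw (s.wt t))⁻¹ * ∑ ξ ∈ (s.set t).filter (· < γ), c ξ

/-- The functional given by a special sequence, truncated at `γ`. -/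
noncomputable def eval (s : Special) (γ : Idx) (c : Idx → ℝ) : ℝ :=
  ∑ t ∈ Finset.range s.len, s.term γ t c

theorem sum_inv_mw_le (s : Special) :
    ∑ t ∈ Finset.range s.len, (mw (s.wt t))⁻¹ ≤ 2 * (1 / 2) ^ s.wt 0 := by
  calc ∑ t ∈ Finset.range s.len, (mw (s.wt t))⁻¹
      ≤ ∑ t ∈ Finset.range s.len, (1 / 2 : ℝ) ^ s.wt 0 * (1 / 2) ^ t := by
        apply Finset.sum_le_sum
        intro t ht
        rw [← pow_add]
        refine (inv_mw_le _).trans ?_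
        exact pow_le_pow_of_le_one (by norm_num) (by norm_num)
          (s.wt_zero_add_le (Finset.mem_range.1 ht))
    _ = (1 / 2 : ℝ) ^ s.wt 0 * ∑ t ∈ Finset.range s.len, (1 / 2 : ℝ) ^ t := by
        rw [Finset.mul_sum]
    _ ≤ (1 / 2 : ℝ) ^ s.wt 0 * 2 := by
        gcongr
        exact sum_geometric_two_le _
    _ = _ := mul_comm _ _

theorem abs_eval_single_le (s : Special) (γ α : Idx) :
    |s.eval γ (Pi.single α 1)| ≤ 2 * (1 / 2) ^ s.wt 0 := by
  refine le_trans ?_ s.sum_inv_mw_le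
  refine (Finset.abs_sum_le_sum_abs _ _).trans ?_
  apply Finset.sum_le_sum
  intro t _
  unfold term
  rw [abs_mul, abs_of_pos (inv_pos.2 (mw_pos _))]
  refine mul_le_of_le_one_right (inv_pos.2 (mw_pos _)).le ?_
  simp only [Pi.single_apply, Finset.sum_ite_eq']
  split_ifs <;> simp

/-- The special sequence of length one given by a single set. -/
def ofSet (p : ℕ) (G : Finset Idx) (hG : G.card ≤ nw p) (hi : IsIncreasing (G : Set Idx)) :
    Special where
  len := 1
  wt _ := p
  set _ := G
  par _ := 0
  len_le := by simp
  card_le _ _ := hG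
  incr := hi.mono fun ξ ⟨_, _, h⟩ => h
  close t ht := by omega
  wt_succ t ht := by omega

theorem eval_ofSet (p : ℕ) (G : Finset Idx) (hG : G.card ≤ nw p)
    (hi : IsIncreasing (G : Set Idx)) (γ : Idx) (c : Idx → ℝ) :
    (ofSet p G hG hi).eval γ c = (mw p)⁻¹ * ∑ ξ ∈ G.filter (· < γ), c ξ := by
  simp [eval, term, ofSet]

theorem isIncreasing_set (s : Special) {t : ℕ} (ht : t < s.len) :
    IsIncreasing (s.set t : Set Idx) := s.incr.mono fun _ h => ⟨t, ht, h⟩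

/-- The special sequence of length one given by the `t`-th set of a special sequence. -/
def nth (s : Special) (t : ℕ) (ht : t < s.len) : Special :=
  ofSet (s.wt t) (s.set t) (s.card_le t ht) (s.isIncreasing_set ht)

theorem eval_nth (s : Special) {t : ℕ} (ht : t < s.len) (γ : Idx) (c : Idx → ℝ) :
    (s.nth t ht).eval γ c = s.term γ t c := eval_ofSet ..

/-- The special sequence given by a singleton. -/
def single (ξ : Idx) : Special :=
  ofSet 0 {ξ} (by simp [nw_zero]) (by simpa using isIncreasing_of_subsingleton (by simp))

end Special

/-! ### The space -/

/-- Indices of the norming functionals. -/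
structure Key where
  /-- the special sequence -/
  seq : Special
  /-- the truncation -/
  cut : Idx

instance : TopologicalSpace Key := ⊥

instance : DiscreteTopology Key := ⟨rfl⟩

open scoped BoundedContinuousFunction

/-- The unit vectors, as bounded functions. -/
noncomputable def unitFun (α : Idx) : Key →ᵇ ℝ :=
  BoundedContinuousFunction.ofNormedAddCommGroupDiscrete
    (fun k => k.seq.eval k.cut (Pi.single α 1)) 2 fun k =>
      (k.seq.abs_eval_single_le k.cut α).trans
        (mul_le_of_le_one_right (by norm_num) (pow_le_one₀ (by norm_num) (by norm_num)))

/-- The closed span of the unit vectors. -/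
noncomputable def spaceSubmodule : Submodule ℝ (Key →ᵇ ℝ) :=
  (Submodule.span ℝ (range unitFun)).topologicalClosure

/-- The nonseparable space. -/
def Space : Type := spaceSubmodule

noncomputable instance : NormedAddCommGroup Space :=
  inferInstanceAs (NormedAddCommGroup spaceSubmodule)

noncomputable instance : NormedSpace ℝ Space :=
  inferInstanceAs (NormedSpace ℝ spaceSubmodule)

instance : CompleteSpace Space :=
  (Submodule.isClosed_topologicalClosure _).completeSpace_coe

/-- The inclusion of the space in the bounded functions. -/
noncomputable def incl : Space →ₗᵢ[ℝ] (Key →ᵇ ℝ) := spaceSubmodule.subtypeₗᵢ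

/-- The norming functionals. -/
noncomputable def ev (s : Special) (γ : Idx) : Space →L[ℝ] ℝ :=
  (BoundedContinuousFunction.evalCLM ℝ (⟨s, γ⟩ : Key)).comp incl.toContinuousLinearMap

theorem abs_ev_le (s : Special) (γ : Idx) (x : Space) : |ev s γ x| ≤ ‖x‖ :=
  (incl x).norm_coe_le_norm _

theorem norm_le_of_abs_ev_le {x : Space} {b : ℝ} (hb : 0 ≤ b) (h : ∀ s γ, |ev s γ x| ≤ b) :
    ‖x‖ ≤ b :=
  (BoundedContinuousFunction.norm_le hb).2 fun k => h k.seq k.cut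

/-- The unit vectors. -/
noncomputable def unit (α : Idx) : Space :=
  ⟨unitFun α, Submodule.le_topologicalClosure _ (Submodule.subset_span (mem_range_self α))⟩

theorem ev_unit (s : Special) (γ α : Idx) : ev s γ (unit α) = s.eval γ (Pi.single α 1) := rfl

theorem dense_span_unit : Dense (Submodule.span ℝ (range unit) : Set Space) := by
  intro x
  rw [Metric.mem_closure_iff]
  intro ε hε
  obtain ⟨v, hv, hd⟩ := Metric.mem_closure_iff.1 x.2 ε hε
  have hmap : (Submodule.span ℝ (range unit)).map incl.toLinearMap =
      Submodule.span ℝ (range unitFun) := by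
    rw [Submodule.map_span, ← range_comp]
    rfl
  have hv' : v ∈ (Submodule.span ℝ (range unit)).map incl.toLinearMap := hmap ▸ hv
  obtain ⟨w, hw, rfl⟩ := hv'
  exact ⟨w, hw, hd⟩

/-- The coordinate functionals. -/
noncomputable def coord (ξ : Idx) : Space →L[ℝ] ℝ :=
  ev (Special.single ξ) (exists_gt ξ).choose

theorem abs_coord_le (ξ : Idx) (x : Space) : |coord ξ x| ≤ ‖x‖ := abs_ev_le _ _ _

theorem coord_unit (ξ α : Idx) : coord ξ (unit α) = (Pi.single α 1 : Idx → ℝ) ξ := by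
  have h := (exists_gt ξ).choose_spec
  rw [coord, ev_unit, Special.single, Special.eval_ofSet, mw_zero,
    Finset.filter_singleton, if_pos h]
  simp [Pi.single_apply, eq_comm]

theorem ev_eq (s : Special) (γ : Idx) (x : Space) : ev s γ x = s.eval γ fun ξ => coord ξ x := by
  set f : Space →L[ℝ] ℝ := ∑ t ∈ Finset.range s.len,
    (mw (s.wt t))⁻¹ • ∑ ξ ∈ (s.set t).filter (· < γ), coord ξ with hf
  have hfx : ∀ x, f x = s.eval γ fun ξ => coord ξ x := by
    intro x
    simp [hf, Special.eval, Special.term]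
  have : ev s γ = f := by
    refine ContinuousLinearMap.ext_on dense_span_unit ?_
    rintro _ ⟨α, rfl⟩
    rw [hfx, ev_unit]
    simp only [coord_unit]
  rw [← hfx, this]

/-- The `t`-th term of the functional given by a special sequence. -/
noncomputable def evTerm (s : Special) (γ : Idx) (t : ℕ) (x : Space) : ℝ :=
  s.term γ t fun ξ => coord ξ x

theorem ev_eq_sum (s : Special) (γ : Idx) (x : Space) :
    ev s γ x = ∑ t ∈ Finset.range s.len, evTerm s γ t x := ev_eq s γ x

theorem evTerm_eq_ev (s : Special) (γ : Idx) {t : ℕ} (ht : t < s.len) (x : Space) :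
    evTerm s γ t x = ev (s.nth t ht) γ x := by
  rw [ev_eq, Special.eval_nth, evTerm]

theorem abs_evTerm_le (s : Special) (γ : Idx) {t : ℕ} (ht : t < s.len) (x : Space) :
    |evTerm s γ t x| ≤ ‖x‖ := by
  rw [evTerm_eq_ev s γ ht]
  exact abs_ev_le _ _ _

theorem evTerm_add (s : Special) (γ : Idx) (t : ℕ) (x y : Space) :
    evTerm s γ t (x + y) = evTerm s γ t x + evTerm s γ t y := by
  simp [evTerm, Special.term, Finset.sum_add_distrib, mul_add]

theorem evTerm_smul (s : Special) (γ : Idx) (t : ℕ) (a : ℝ) (x : Space) :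
    evTerm s γ t (a • x) = a * evTerm s γ t x := by
  simp only [evTerm, Special.term, map_smul, smul_eq_mul, ← Finset.mul_sum]
  ring

theorem ext_coord {x y : Space} (h : ∀ ξ, coord ξ x = coord ξ y) : x = y := by
  have : ‖x - y‖ ≤ 0 := norm_le_of_abs_ev_le le_rfl fun s γ => by
    simp [map_sub, ev_eq, h]
  exact sub_eq_zero.1 (norm_le_zero_iff.1 this)

theorem exists_mem_span_norm_sub_lt (x : Space) {ε : ℝ} (hε : 0 < ε) :
    ∃ v ∈ Submodule.span ℝ (range unit), ‖x - v‖ < ε := by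
  obtain ⟨v, hv, h⟩ := Metric.mem_closure_iff.1 (dense_span_unit x) ε hε
  exact ⟨v, hv, by rwa [dist_eq_norm] at h⟩

theorem finite_support {v : Space} (hv : v ∈ Submodule.span ℝ (range unit)) :
    {ξ | coord ξ v ≠ 0}.Finite := by
  induction hv using Submodule.span_induction with
  | mem x h =>
    obtain ⟨α, rfl⟩ := h
    refine (finite_singleton α).subset fun ξ hξ => ?_
    by_contra hne
    exact hξ (by rw [coord_unit, Pi.single_eq_of_ne hne])
  | zero => simp
  | add x y _ _ hx hy =>
    refine (hx.union hy).subset fun ξ hξ => ?_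
    by_contra hne
    simp only [mem_union, mem_ofPred_eq, not_or, not_not] at hne
    exact hξ (by rw [map_add, hne.1, hne.2, add_zero])
  | smul a x _ hx =>
    refine hx.subset fun ξ hξ h0 => hξ ?_
    rw [map_smul, h0, smul_zero]

theorem finite_abs_coord_gt (x : Space) {η : ℝ} (hη : 0 < η) : {ξ | η < |coord ξ x|}.Finite := by
  obtain ⟨v, hv, h⟩ := exists_mem_span_norm_sub_lt x hη
  refine (finite_support hv).subset fun ξ hξ h0 => ?_
  have h1 := abs_coord_le ξ (x - v)
  rw [map_sub, h0, sub_zero] at h1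
  have : η < |coord ξ x| := hξ
  linarith

theorem exists_forall_abs_ev_le (x : Space) {η : ℝ} (hη : 0 < η) :
    ∃ J, ∀ s : Special, J ≤ s.wt 0 → ∀ γ, |ev s γ x| ≤ η := by
  have hspan : ∀ v ∈ Submodule.span ℝ (range unit), ∀ η > 0,
      ∃ J, ∀ s : Special, J ≤ s.wt 0 → ∀ γ, |ev s γ v| ≤ η := by
    intro v hv
    induction hv using Submodule.span_induction with
    | mem x h =>
      obtain ⟨α, rfl⟩ := h
      intro η hη
      obtain ⟨J, hJ⟩ := exists_pow_lt_of_lt_one (half_pos hη) (by norm_num : (1 / 2 : ℝ) < 1)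
      refine ⟨J, fun s hs γ => (s.abs_eval_single_le γ α).trans ?_⟩
      have := pow_le_pow_of_le_one (by norm_num : (0 : ℝ) ≤ 1 / 2) (by norm_num) hs
      linarith
    | zero => intro η hη; exact ⟨0, fun s _ γ => by simpa using hη.le⟩
    | add x y _ _ hx hy =>
      intro η hη
      obtain ⟨J, hJ⟩ := hx (η / 2) (half_pos hη)
      obtain ⟨J', hJ'⟩ := hy (η / 2) (half_pos hη)
      refine ⟨max J J', fun s hs γ => ?_⟩
      rw [map_add]
      have h1 := hJ s ((le_max_left _ _).trans hs) γ
      have h2 := hJ' s ((le_max_right _ _).trans hs) γ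
      linarith [abs_add_le (ev s γ x) (ev s γ y)]
    | smul a x _ hx =>
      intro η hη
      obtain ⟨J, hJ⟩ := hx (η / (|a| + 1)) (by positivity)
      refine ⟨J, fun s hs γ => ?_⟩
      rw [map_smul, smul_eq_mul, abs_mul]
      have h1 := hJ s hs γ
      rw [le_div_iff₀ (by positivity)] at h1
      nlinarith [abs_nonneg (ev s γ x), abs_nonneg a]
  obtain ⟨v, hv, h⟩ := exists_mem_span_norm_sub_lt x (half_pos hη)
  obtain ⟨J, hJ⟩ := hspan v hv (η / 2) (half_pos hη)
  refine ⟨J, fun s hs γ => ?_⟩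
  have h1 := hJ s hs γ
  have h2 := abs_ev_le s γ (x - v)
  rw [map_sub] at h2
  have := abs_add_le (ev s γ x - ev s γ v) (ev s γ v)
  rw [sub_add_cancel] at this
  linarith

/-! ### Projections on initial segments -/

/-- Truncation, on bounded functions. -/
noncomputable def projFun (γ : Idx) : (Key →ᵇ ℝ) →L[ℝ] (Key →ᵇ ℝ) :=
  BoundedContinuousFunction.compContinuousCLM ℝ ℝ
    (⟨fun k => ⟨k.seq, min γ k.cut⟩, continuous_of_discreteTopology⟩ : C(Key, Key))

theorem projFun_apply (γ : Idx) (x : Key →ᵇ ℝ) (k : Key) :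
    projFun γ x k = x ⟨k.seq, min γ k.cut⟩ := rfl

theorem projFun_unitFun (γ α : Idx) :
    projFun γ (unitFun α) = if α < γ then unitFun α else 0 := by
  ext k
  rw [projFun_apply]
  change k.seq.eval (min γ k.cut) (Pi.single α 1) = _
  split_ifs with h
  · change _ = k.seq.eval k.cut (Pi.single α 1)
    simp [Special.eval, Special.term, h]
  · simp [Special.eval, Special.term, h]

theorem projFun_mem (γ : Idx) {x : Key →ᵇ ℝ} (hx : x ∈ spaceSubmodule) :
    projFun γ x ∈ spaceSubmodule := by
  refine map_mem_closure (projFun γ).continuous hx fun y hy => ?_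
  induction hy using Submodule.span_induction with
  | mem y h =>
    obtain ⟨α, rfl⟩ := h
    rw [projFun_unitFun]
    split_ifs
    · exact Submodule.subset_span (mem_range_self α)
    · exact zero_mem (Submodule.span ℝ (range unitFun))
  | zero =>
    rw [map_zero]
    exact zero_mem (Submodule.span ℝ (range unitFun))
  | add y z _ _ hy hz =>
    rw [map_add]
    exact Submodule.add_mem _ hy hz
  | smul a y _ hy =>
    rw [map_smul]
    exact Submodule.smul_mem _ a hy

/-- The projection on the coordinates below `γ`. -/
noncomputable def proj (γ : Idx) : Space →L[ℝ] Space :=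
  ((projFun γ).comp spaceSubmodule.subtypeL).codRestrict spaceSubmodule fun x =>
    projFun_mem γ x.2

theorem ev_proj (s : Special) (γ δ : Idx) (x : Space) :
    ev s δ (proj γ x) = ev s (min γ δ) x := rfl

theorem norm_proj_le (γ : Idx) (x : Space) : ‖proj γ x‖ ≤ ‖x‖ :=
  norm_le_of_abs_ev_le (norm_nonneg x) fun s δ => by
    rw [ev_proj]
    exact abs_ev_le _ _ _

theorem proj_unit (γ α : Idx) : proj γ (unit α) = if α < γ then unit α else 0 := by
  apply Subtype.ext
  have := projFun_unitFun γ α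
  split_ifs with h
  · rw [if_pos h] at this
    exact this
  · rw [if_neg h] at this
    exact this

theorem coord_proj (ξ γ : Idx) (x : Space) :
    coord ξ (proj γ x) = if ξ < γ then coord ξ x else 0 := by
  have h : (coord ξ).comp (proj γ) = if ξ < γ then coord ξ else 0 := by
    refine ContinuousLinearMap.ext_on dense_span_unit ?_
    rintro _ ⟨α, rfl⟩
    rw [ContinuousLinearMap.comp_apply, proj_unit]
    by_cases hξ : ξ = α
    · subst hξ
      split_ifs <;> simp
    · split_ifs <;> simp [coord_unit, hξ]
  have := congrArg (fun f : Space →L[ℝ] ℝ => f x) h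
  simp only [ContinuousLinearMap.comp_apply] at this
  rw [this]
  split_ifs <;> simp

theorem isSeparable_range_proj (γ : Idx) :
    TopologicalSpace.IsSeparable (range (proj γ)) := by
  have h1 : TopologicalSpace.IsSeparable
      (Submodule.span ℝ (unit '' Iio γ) : Set Space) :=
    (((countable_Iio_idx γ).image unit).isSeparable).span
  refine h1.closure.mono ?_
  rintro _ ⟨x, rfl⟩
  refine map_mem_closure (proj γ).continuous (dense_span_unit x) fun y hy => ?_
  induction hy using Submodule.span_induction with
  | mem y h =>
    obtain ⟨α, rfl⟩ := h
    rw [proj_unit]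
    split_ifs with h
    · exact Submodule.subset_span ⟨α, h, rfl⟩
    · exact zero_mem (Submodule.span ℝ (unit '' Iio γ))
  | zero =>
    rw [map_zero]
    exact zero_mem (Submodule.span ℝ (unit '' Iio γ))
  | add y z _ _ hy hz =>
    rw [map_add]
    exact Submodule.add_mem _ hy hz
  | smul a y _ hy =>
    rw [map_smul]
    exact Submodule.smul_mem _ a hy

theorem proj_eq_self {γ : Idx} {x : Space} (h : ∀ ξ, γ ≤ ξ → coord ξ x = 0) : proj γ x = x := by
  refine ext_coord fun ξ => ?_
  rw [coord_proj]
  split_ifs with hξ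
  · rfl
  · exact (h ξ (not_lt.1 hξ)).symm

theorem isSeparable_of_coord_eq_zero {S : Set Space} {γ : Idx}
    (h : ∀ x ∈ S, ∀ ξ, γ ≤ ξ → coord ξ x = 0) : TopologicalSpace.IsSeparable S :=
  (isSeparable_range_proj γ).mono fun x hx => ⟨x, proj_eq_self (h x hx)⟩

theorem not_separableSpace : ¬ TopologicalSpace.SeparableSpace Space := by
  intro hs
  have hd : Pairwise fun α β : Idx => 1 ≤ dist (unit α) (unit β) := by
    intro α β hne
    rw [dist_eq_norm]
    refine le_trans ?_ (abs_coord_le α _)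
    simp [coord_unit, hne]
  obtain ⟨S, hS, hSd⟩ := TopologicalSpace.exists_countable_dense Space
  have : ∀ α, ∃ v ∈ S, dist (unit α) v < 1 / 2 := fun α => hSd.exists_dist_lt _ (by norm_num)
  choose f hfS hf using this
  have hinj : Function.Injective f := by
    intro α β hαβ
    by_contra hne
    have h1 := hd hne
    have h2 := hf α
    have h3 := hf β
    rw [← hαβ] at h3
    have := dist_triangle_right (unit α) (unit β) (f α)
    linarith
  have : Countable S := hS
  have : Countable Idx :=
    Function.Injective.countable (f := codRestrict f S hfS) (hinj.codRestrict hfS)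
  exact not_countable this

/-! ### A criterion for containing `c₀` -/

section Czero

variable {E : Type} [NormedAddCommGroup E] [NormedSpace ℝ E]

theorem abs_apply_le_norm_czero (a : czero) (k : ℕ) : |a k| ≤ ‖a‖ := by
  rw [← ZeroAtInftyContinuousMap.norm_toBCF_eq_norm]
  exact a.toBCF.norm_coe_le_norm k

theorem norm_czero_le {a : czero} {b : ℝ} (hb : 0 ≤ b) (h : ∀ k, |a k| ≤ b) : ‖a‖ ≤ b := by
  rw [← ZeroAtInftyContinuousMap.norm_toBCF_eq_norm]
  exact (BoundedContinuousFunction.norm_le hb).2 h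

theorem finite_abs_czero_ge (a : czero) {ε : ℝ} (hε : 0 < ε) : {k | ε ≤ |a k|}.Finite := by
  have h := a.zero_at_infty'
  rw [Filter.cocompact_eq_cofinite, Metric.tendsto_nhds] at h
  have := h ε hε
  rw [Filter.eventually_cofinite] at this
  refine this.subset fun k hk => ?_
  change ¬ dist (a k) 0 < ε
  rw [Real.dist_eq, sub_zero]
  exact not_lt.2 hk

/-- A sequence `y` which is both upper and lower `c₀` spans a copy of `c₀`. -/
theorem exists_equiv_czero [CompleteSpace E] (Y : Submodule ℝ E) (hY : IsClosed (Y : Set E))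
    (y : ℕ → E) (hyY : ∀ k, y k ∈ Y) {C c : ℝ} (hC : 0 ≤ C) (hc : 0 < c)
    (hup : ∀ (a : ℕ → ℝ) (s : Finset ℕ) (b : ℝ), 0 ≤ b → (∀ k ∈ s, |a k| ≤ b) →
      ‖∑ k ∈ s, a k • y k‖ ≤ C * b)
    (hlow : ∀ (a : ℕ → ℝ) (s : Finset ℕ) (b : ℝ), (∀ l, |a l| ≤ b) → ∀ k ∈ s,
      c * |a k| ≤ ‖∑ k ∈ s, a k • y k‖ + c / 2 * b) :
    ∃ Z : Submodule ℝ E, Z ≤ Y ∧ IsClosed (Z : Set E) ∧ Nonempty (Z ≃L[ℝ] czero) := by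
  have hsum : ∀ a : czero, Summable fun k => a k • y k := by
    intro a
    rw [summable_iff_vanishing_norm]
    intro ε hε
    have hε' : 0 < ε / (C + 1) := by positivity
    refine ⟨(finite_abs_czero_ge a hε').toFinset, fun t ht => ?_⟩
    have := hup a t (ε / (C + 1)) hε'.le fun k hk => by
      by_contra hlt
      exact Finset.disjoint_left.1 ht hk ((finite_abs_czero_ge a hε').mem_toFinset.2
        (not_le.1 hlt).le)
    refine this.trans_lt ?_
    rw [mul_div_assoc', div_lt_iff₀ (by positivity)]
    nlinarith
  have hle : ∀ a : czero, ‖∑' k, a k • y k‖ ≤ C * ‖a‖ := fun a =>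
    le_of_tendsto (hsum a).hasSum.norm (Filter.Eventually.of_forall fun s =>
      hup a s ‖a‖ (norm_nonneg a) fun k _ => abs_apply_le_norm_czero a k)
  let T0 : czero →ₗ[ℝ] E :=
    { toFun := fun a => ∑' k, a k • y k
      map_add' := fun a b => by
        rw [← (hsum a).tsum_add (hsum b)]
        exact tsum_congr fun k => add_smul _ _ _
      map_smul' := fun r a => by
        rw [RingHom.id_apply, ← (hsum a).tsum_const_smul]
        exact tsum_congr fun k => mul_smul _ _ _ }
  let T : czero →L[ℝ] E := T0.mkContinuous C hle
  have hT : ∀ a, T a = ∑' k, a k • y k := fun a => rfl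
  have hbelow : ∀ a : czero, ‖a‖ ≤ 2 / c * ‖T a‖ := by
    intro a
    have h1 : ∀ k, c * |a k| ≤ ‖T a‖ + c / 2 * ‖a‖ := by
      intro k
      refine ge_of_tendsto ((hsum a).hasSum.norm.add_const _) ?_
      filter_upwards [Filter.eventually_ge_atTop {k}] with s hs
      exact hlow a s ‖a‖ (abs_apply_le_norm_czero a) k (hs (Finset.mem_singleton_self k))
    have h2 : ‖a‖ ≤ (‖T a‖ + c / 2 * ‖a‖) / c := by
      refine norm_czero_le (by positivity) fun k => ?_
      rw [le_div_iff₀ hc, mul_comm]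
      exact h1 k
    rw [le_div_iff₀ hc] at h2
    rw [div_mul_eq_mul_div, le_div_iff₀ hc]
    linarith
  have hanti : AntilipschitzWith (Real.toNNReal (2 / c)) T := by
    refine AddMonoidHomClass.antilipschitz_of_bound T fun a => ?_
    rw [Real.coe_toNNReal _ (by positivity)]
    exact hbelow a
  have hcl : IsClosed (range T) := hanti.isClosed_range T.uniformContinuous
  refine ⟨T.range, ?_, ?_, ⟨(T.equivRange hanti.injective hcl).symm⟩⟩
  · rintro _ ⟨a, rfl⟩
    refine hY.mem_of_tendsto (hsum a).hasSum (Filter.Eventually.of_forall fun s => ?_)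
    exact Submodule.sum_mem _ fun k _ => Y.smul_mem _ (hyY k)
  · rw [LinearMap.coe_range]
    exact hcl

theorem exists_pos_le_finset {α : Type} (s : Finset α) (g : α → ℝ) {ε : ℝ} (hε : 0 < ε)
    (hg : ∀ q ∈ s, 0 < g q) : ∃ η : ℝ, 0 < η ∧ η ≤ ε ∧ ∀ q ∈ s, η ≤ g q := by
  classical
  induction s using Finset.induction_on with
  | empty => exact ⟨ε, hε, le_rfl, by simp⟩
  | insert a s _ ih =>
    obtain ⟨η, h0, h1, h2⟩ := ih fun q hq => hg q (Finset.mem_insert_of_mem hq)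
    refine ⟨min η (g a), lt_min h0 (hg a (Finset.mem_insert_self _ _)),
      (min_le_left _ _).trans h1, fun q hq => ?_⟩
    rcases Finset.mem_insert.1 hq with rfl | hq
    · exact min_le_right _ _
    · exact (min_le_left _ _).trans (h2 q hq)

/-- From vectors small on all functionals not small on a given finite set, extract a sequence. -/
theorem exists_seq_almost_disjoint (Y : Submodule ℝ E) {ι : Type} (f : ι → E →L[ℝ] ℝ)
    (H : ∀ (F : Finset E) (η : ℝ), 0 < η → ∃ y ∈ Y, ‖y‖ = 1 ∧
      ∀ i, (∃ y' ∈ F, η < |f i y'|) → |f i y| ≤ η) {ε : ℝ} (hε : 0 < ε) :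
    ∃ (y : ℕ → E) (η : ℕ → ℝ), (∀ k, y k ∈ Y) ∧ (∀ k, ‖y k‖ = 1) ∧ (∀ k, η k ≤ ε) ∧
      (∀ s : Finset ℕ, ∑ k ∈ s, η k ≤ 2 * ε) ∧
      ∀ i k l, k ≠ l → η k < |f i (y k)| → |f i (y l)| ≤ η l := by
  classical
  obtain ⟨u, hu1, hu2⟩ := exists_seq_of_forall_finset_exists
    (fun q : E × ℝ => q.1 ∈ Y ∧ ‖q.1‖ = 1 ∧ 0 < q.2 ∧ q.2 ≤ ε)
    (fun q q' => q'.2 ≤ q.2 / 2 ∧ ∀ i, q.2 < |f i q.1| → |f i q'.1| ≤ q'.2) (by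
      intro s hs
      obtain ⟨η, hη0, hηε, hη⟩ : ∃ η : ℝ, 0 < η ∧ η ≤ ε ∧ ∀ q ∈ s, η ≤ q.2 / 2 := by
        exact exists_pos_le_finset s _ hε fun q hq => half_pos (hs q hq).2.2.1
      obtain ⟨y, hyY, hy1, hy⟩ := H (s.image Prod.fst) η hη0
      refine ⟨(y, η), ⟨hyY, hy1, hη0, hηε⟩, fun q hq => ⟨hη q hq, fun i hi => hy i
        ⟨q.1, Finset.mem_image_of_mem _ hq, ?_⟩⟩⟩
      have h1 := hη q hq
      have h2 := (hs q hq).2.2.1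
      linarith)
  obtain ⟨y, hy⟩ : ∃ y : ℕ → E, ∀ k, (u k).1 = y k := ⟨_, fun _ => rfl⟩
  obtain ⟨η, hη⟩ : ∃ η : ℕ → ℝ, ∀ k, (u k).2 = η k := ⟨_, fun _ => rfl⟩
  simp only [hy, hη] at hu1 hu2
  have hηle : ∀ k, η k ≤ ε * (1 / 2) ^ k := by
    intro k
    induction k with
    | zero => simpa using (hu1 0).2.2.2
    | succ k ih =>
      have := (hu2 k (k + 1) (Nat.lt_succ_self k)).1
      rw [pow_succ]
      linarith
  have hηε : ∀ k, η k ≤ ε := fun k => (hu1 k).2.2.2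
  have hηpos : ∀ k, 0 < η k := fun k => (hu1 k).2.2.1
  have hηsum : ∀ s : Finset ℕ, ∑ k ∈ s, η k ≤ 2 * ε := by
    intro s
    calc ∑ k ∈ s, η k ≤ ∑ k ∈ s, ε * (1 / 2) ^ k := Finset.sum_le_sum fun k _ => hηle k
      _ = ε * ∑ k ∈ s, (1 / 2 : ℝ) ^ k := by rw [Finset.mul_sum]
      _ ≤ ε * 2 := by
        gcongr
        have := summable_geometric_two.sum_le_tsum s (fun k _ => by positivity)
        rwa [tsum_geometric_two] at this
      _ = 2 * ε := mul_comm _ _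
  have hone : ∀ i k l, k ≠ l → η k < |f i (y k)| → |f i (y l)| ≤ η l := by
    intro i k l hkl hk
    rcases lt_or_gt_of_ne hkl with h | h
    · exact (hu2 k l h).2 i hk
    · by_contra hl
      exact absurd ((hu2 l k h).2 i (not_le.1 hl)) (not_le.2 hk)
  exact ⟨y, η, fun k => (hu1 k).1, fun k => (hu1 k).2.1, hηε, hηsum, hone⟩

/-- A closed subspace `Y` contains `c₀` if, for some norming family of functionals, there are
normalized vectors of `Y` small on all functionals that are not small on a given finite set. -/
theorem exists_czero_of_norming [CompleteSpace E] (Y : Submodule ℝ E)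
    (hY : IsClosed (Y : Set E)) {ι : Type} (f : ι → E →L[ℝ] ℝ) (hf : ∀ i x, |f i x| ≤ ‖x‖)
    {C : ℝ} (hC : ∀ x ∈ Y, ∀ b, 0 ≤ b → (∀ i, |f i x| ≤ b) → ‖x‖ ≤ C * b)
    (H : ∀ (F : Finset E) (η : ℝ), 0 < η → ∃ y ∈ Y, ‖y‖ = 1 ∧
      ∀ i, (∃ y' ∈ F, η < |f i y'|) → |f i y| ≤ η) :
    ∃ Z : Submodule ℝ E, Z ≤ Y ∧ IsClosed (Z : Set E) ∧ Nonempty (Z ≃L[ℝ] czero) := by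
  classical
  have hC1 : 1 ≤ C := by
    obtain ⟨y, hy, h1, -⟩ := H ∅ 1 one_pos
    have := hC y hy 1 zero_le_one fun i => h1 ▸ hf i y
    linarith
  set ε : ℝ := 1 / (8 * C) with hε
  have hε0 : 0 < ε := by positivity
  have hεC : C * ε = 1 / 8 := by rw [hε]; field_simp
  obtain ⟨y, η, hyY, hy1, hηε, hηsum, hone⟩ := exists_seq_almost_disjoint Y f H hε0
  have hrest : ∀ i k (s : Finset ℕ) (a : ℕ → ℝ) (b : ℝ), 0 ≤ b → (∀ l ∈ s, |a l| ≤ b) →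
      (∀ l ∈ s, l ≠ k → |f i (y l)| ≤ η l) →
      |∑ l ∈ s.erase k, a l * f i (y l)| ≤ b * (2 * ε) := by
    intro i k s a b hb ha hk
    refine (Finset.abs_sum_le_sum_abs _ _).trans ?_
    calc ∑ l ∈ s.erase k, |a l * f i (y l)| ≤ ∑ l ∈ s.erase k, b * η l := by
          refine Finset.sum_le_sum fun l hl => ?_
          rw [abs_mul]
          have hl' := Finset.mem_erase.1 hl
          exact mul_le_mul (ha l hl'.2) (hk l hl'.2 hl'.1) (abs_nonneg _) hb
      _ = b * ∑ l ∈ s.erase k, η l := by rw [Finset.mul_sum]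
      _ ≤ b * (2 * ε) := mul_le_mul_of_nonneg_left (hηsum _) hb
  have hfs : ∀ i (s : Finset ℕ) (a : ℕ → ℝ),
      f i (∑ k ∈ s, a k • y k) = ∑ k ∈ s, a k * f i (y k) := fun i s a => by simp
  refine exists_equiv_czero Y hY y hyY (C := 2 * C) (c := 1 / (2 * C)) (by positivity)
    (by positivity) ?_ ?_
  · intro a s b hb ha
    have hmem : ∑ k ∈ s, a k • y k ∈ Y := Submodule.sum_mem _ fun k _ => Y.smul_mem _ (hyY k)
    have : ‖∑ k ∈ s, a k • y k‖ ≤ C * (b * (1 + 2 * ε)) := by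
      refine hC _ hmem _ (by positivity) fun i => ?_
      rw [hfs]
      by_cases hex : ∃ k ∈ s, η k < |f i (y k)|
      · obtain ⟨k, hks, hk⟩ := hex
        rw [← Finset.add_sum_erase _ _ hks]
        have h1 := hrest i k s a b hb ha fun l _ hl => hone i k l hl.symm hk
        have h2 : |a k * f i (y k)| ≤ b * 1 := by
          rw [abs_mul]
          exact mul_le_mul (ha k hks) (hy1 k ▸ hf i (y k)) (abs_nonneg _) hb
        linarith [abs_add_le (a k * f i (y k)) (∑ l ∈ s.erase k, a l * f i (y l))]
      · push Not at hex
        obtain ⟨k, hk⟩ := Infinite.exists_notMem_finset s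
        have h1 := hrest i k s a b hb ha fun l hl _ => hex l hl
        rw [Finset.erase_eq_of_notMem hk] at h1
        linarith
    have h2 : ε ≤ 1 / 8 := by nlinarith
    nlinarith [mul_nonneg (by linarith : (0 : ℝ) ≤ C) hb]
  · intro a s b ha k hks
    have hb : 0 ≤ b := (abs_nonneg _).trans (ha 0)
    obtain ⟨i, hi⟩ : ∃ i, 1 / (2 * C) < |f i (y k)| := by
      by_contra! hcon
      have h1 := hC (y k) (hyY k) (1 / (2 * C)) (by positivity) hcon
      rw [hy1, show C * (1 / (2 * C)) = 1 / 2 by field_simp] at h1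
      norm_num at h1
    have hε2 : 1 / (2 * C) = 4 * ε := by rw [hε]; field_simp; norm_num
    have h1 := hrest i k s a b hb (fun l _ => ha l) fun l _ hl => hone i k l hl.symm (by
      have := hηε k
      linarith)
    have h2 := hf i (∑ k ∈ s, a k • y k)
    rw [hfs, ← Finset.add_sum_erase _ _ hks] at h2
    have h3 : 1 / (2 * C) * |a k| ≤ |a k * f i (y k)| := by
      rw [abs_mul, mul_comm]
      exact mul_le_mul_of_nonneg_left hi.le (abs_nonneg _)
    have h4 := abs_sub_abs_le_abs_sub (a k * f i (y k)) (-∑ l ∈ s.erase k, a l * f i (y l))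
    rw [sub_neg_eq_add, abs_neg] at h4
    have h5 : 1 / (2 * C) / 2 * b = b * (2 * ε) := by rw [hε2]; ring
    linarith

end Czero

/-! ### The space is `c₀`-saturated -/

section Subspaces

variable {E : Type} [NormedAddCommGroup E] [NormedSpace ℝ E]

theorem exists_norm_eq_one_forall_apply_eq_zero (Y : Submodule ℝ E)
    (hdim : ¬ FiniteDimensional ℝ Y) {ι : Type} (f : ι → E →L[ℝ] ℝ) (T : Finset ι) :
    ∃ y ∈ Y, ‖y‖ = 1 ∧ ∀ i ∈ T, f i y = 0 := by
  let L : Y →ₗ[ℝ] (T → ℝ) :=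
    LinearMap.pi fun i => (f i.1).toLinearMap.comp Y.subtype
  have hL : ¬ Function.Injective L := fun h => hdim (FiniteDimensional.of_injective L h)
  rw [injective_iff_map_eq_zero] at hL
  push Not at hL
  obtain ⟨x, hx, hne⟩ := hL
  have hne' : (x : E) ≠ 0 := fun h => hne (Subtype.ext h)
  refine ⟨‖(x : E)‖⁻¹ • (x : E), Y.smul_mem _ x.2, by
    rw [norm_smul, norm_inv, norm_norm, inv_mul_cancel₀ (norm_ne_zero_iff.2 hne')], fun i hi => ?_⟩
  have : f i x = 0 := congrFun hx ⟨i, hi⟩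
  rw [map_smul, this, smul_zero]

theorem exists_norm_eq_one_forall_abs_le (Y : Submodule ℝ E) {ι : Type} (f : ι → E →L[ℝ] ℝ)
    (h : ¬ ∃ C, ∀ x ∈ Y, ∀ b, 0 ≤ b → (∀ i, |f i x| ≤ b) → ‖x‖ ≤ C * b) {ε : ℝ} (hε : 0 < ε) :
    ∃ y ∈ Y, ‖y‖ = 1 ∧ ∀ i, |f i y| ≤ ε := by
  push Not at h
  obtain ⟨x, hxY, b, hb, hx, hlt⟩ := h ε⁻¹
  have hpos : 0 < ‖x‖ := lt_of_le_of_lt (by positivity) hlt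
  refine ⟨‖x‖⁻¹ • x, Y.smul_mem _ hxY, ?_, fun i => ?_⟩
  · rw [norm_smul, norm_inv, norm_norm, inv_mul_cancel₀ hpos.ne']
  · rw [map_smul, smul_eq_mul, abs_mul, abs_inv, abs_norm, inv_mul_le_iff₀ hpos]
    rw [inv_mul_lt_iff₀ hε] at hlt
    linarith [hx i]

end Subspaces

theorem abs_evTerm_le_of_abs_coord_le (s : Special) (γ : Idx) {t : ℕ} (ht : t < s.len)
    {x : Space} {b : ℝ} (hb : 0 ≤ b) (hx : ∀ ξ, |coord ξ x| ≤ b) :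
    |evTerm s γ t x| ≤ nw (s.wt t) * b := by
  unfold evTerm Special.term
  rw [abs_mul, abs_of_pos (inv_pos.2 (mw_pos _))]
  have h1 : |∑ ξ ∈ (s.set t).filter (· < γ), coord ξ x| ≤ nw (s.wt t) * b := by
    refine (Finset.abs_sum_le_sum_abs _ _).trans ?_
    refine (Finset.sum_le_card_nsmul _ _ b fun ξ _ => hx ξ).trans ?_
    rw [nsmul_eq_mul]
    gcongr
    exact (Finset.card_filter_le _ _).trans (s.card_le t ht)
  refine (mul_le_of_le_one_left (abs_nonneg _) ?_).trans h1
  exact inv_le_one_of_one_le₀ (one_le_mw _)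

theorem exists_forall_mem_abs_ev_le (F : Finset Space) {η : ℝ} (hη : 0 < η) :
    ∃ J, ∀ x ∈ F, ∀ s : Special, J ≤ s.wt 0 → ∀ γ, |ev s γ x| ≤ η := by
  choose J hJ using fun x => exists_forall_abs_ev_le x hη
  exact ⟨F.sup J, fun x hx s hs γ => hJ x s ((Finset.le_sup hx).trans hs) γ⟩

theorem nw_mono : Monotone nw := fun a b h =>
  Nat.pow_le_pow_right (by norm_num) (Nat.mul_le_mul_left _ (Nat.pow_le_pow_left h 3))

theorem exists_czero_subspace (Y : Submodule ℝ Space) (hY : IsClosed (Y : Set Space))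
    (hdim : ¬ FiniteDimensional ℝ Y) :
    ∃ Z : Submodule ℝ Space, Z ≤ Y ∧ IsClosed (Z : Set Space) ∧ Nonempty (Z ≃L[ℝ] czero) := by
  by_cases hA : ∃ C, ∀ x ∈ Y, ∀ b, 0 ≤ b → (∀ ξ, |coord ξ x| ≤ b) → ‖x‖ ≤ C * b
  · obtain ⟨C, hC⟩ := hA
    refine exists_czero_of_norming Y hY coord abs_coord_le hC fun F η hη => ?_
    have hfin : (⋃ y' ∈ F, {ξ | η < |coord ξ y'|}).Finite :=
      F.finite_toSet.biUnion fun y' _ => finite_abs_coord_gt y' hη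
    obtain ⟨y, hyY, hy1, hy⟩ :=
      exists_norm_eq_one_forall_apply_eq_zero Y hdim coord hfin.toFinset
    refine ⟨y, hyY, hy1, fun ξ ⟨y', hy', h⟩ => ?_⟩
    rw [hy ξ (hfin.mem_toFinset.2 (mem_biUnion hy' h)), abs_zero]
    exact hη.le
  have hA' := fun {ε : ℝ} (hε : 0 < ε) => exists_norm_eq_one_forall_abs_le Y coord hA hε
  let f : {s : Special // s.len ≤ 1} × Idx → Space →L[ℝ] ℝ := fun q => ev q.1.1 q.2
  by_cases hB : ∃ C, ∀ x ∈ Y, ∀ b, 0 ≤ b → (∀ q, |f q x| ≤ b) → ‖x‖ ≤ C * b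
  · obtain ⟨C, hC⟩ := hB
    refine exists_czero_of_norming Y hY f (fun q => abs_ev_le _ _) hC fun F η hη => ?_
    obtain ⟨J, hJ⟩ := exists_forall_mem_abs_ev_le F hη
    obtain ⟨y, hyY, hy1, hy⟩ := hA' (div_pos hη (cast_nw_pos J))
    refine ⟨y, hyY, hy1, fun ⟨⟨s, hs⟩, γ⟩ ⟨y', hy', h⟩ => ?_⟩
    change |ev s γ y| ≤ η
    have hJs : s.wt 0 < J := by
      by_contra hle
      exact absurd (hJ y' hy' s (not_lt.1 hle) γ) (not_le.2 h)
    rw [ev_eq_sum]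
    rcases Nat.le_one_iff_eq_zero_or_eq_one.1 hs with h0 | h1
    · simpa [h0] using hη.le
    · rw [h1, Finset.sum_range_one]
      refine (abs_evTerm_le_of_abs_coord_le s γ (by omega)
        (div_pos hη (cast_nw_pos J)).le hy).trans ?_
      rw [mul_div_assoc', div_le_iff₀ (cast_nw_pos J), mul_comm]
      gcongr
      exact nw_mono hJs.le
  have hB' := fun {ε : ℝ} (hε : 0 < ε) => exists_norm_eq_one_forall_abs_le Y f hB hε
  refine exists_czero_of_norming Y hY (fun q : Special × Idx => ev q.1 q.2)
    (fun q => abs_ev_le _ _) (C := 1)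
    (fun x _ b hb h => by
      rw [one_mul]
      exact norm_le_of_abs_ev_le hb fun s γ => h (s, γ)) fun F η hη => ?_
  obtain ⟨J, hJ⟩ := exists_forall_mem_abs_ev_le F hη
  obtain ⟨y, hyY, hy1, hy⟩ := hB' (ε := η / (J + 1)) (by positivity)
  refine ⟨y, hyY, hy1, fun ⟨s, γ⟩ ⟨y', hy', h⟩ => ?_⟩
  change |ev s γ y| ≤ η
  have hJs : s.wt 0 < J := by
    by_contra hle
    exact absurd (hJ y' hy' s (not_lt.1 hle) γ) (not_le.2 h)
  rw [ev_eq_sum]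
  refine (Finset.abs_sum_le_sum_abs _ _).trans ?_
  have h1 : ∀ t ∈ Finset.range s.len, |evTerm s γ t y| ≤ η / (J + 1) := fun t ht => by
    rw [evTerm_eq_ev s γ (Finset.mem_range.1 ht)]
    exact hy (⟨s.nth t (Finset.mem_range.1 ht), le_rfl⟩, γ)
  refine (Finset.sum_le_card_nsmul _ _ _ h1).trans ?_
  rw [Finset.card_range, nsmul_eq_mul, mul_div_assoc', div_le_iff₀ (by positivity), mul_comm]
  have : (s.len : ℝ) ≤ J + 1 := by
    have := s.len_le
    exact_mod_cast (by omega : s.len ≤ J + 1)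
  gcongr

/-! ### Blocks close to a nonseparable subspace -/

theorem exists_not_countable_fiber {β : Type*} {A : Set Idx} (hA : ¬ A.Countable) {C : Set β}
    (hC : C.Countable) (f : Idx → β) (hf : ∀ a ∈ A, f a ∈ C) :
    ∃ b ∈ C, ¬ {a ∈ A | f a = b}.Countable := by
  by_contra! h
  refine hA ((hC.biUnion h).mono fun a ha => ?_)
  exact mem_biUnion (hf a ha) ⟨ha, rfl⟩

theorem exists_bounded_family {X₀ : Submodule ℝ Space}
    (hX : ¬ TopologicalSpace.IsSeparable (X₀ : Set Space)) :
    ∃ (M : ℝ) (A : Set Idx) (x : Idx → Space), 0 ≤ M ∧ ¬ A.Countable ∧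
      ∀ α ∈ A, x α ∈ X₀ ∧ coord α (x α) = 1 ∧ ‖x α‖ ≤ M := by
  classical
  set A : Set Idx := {α | ∃ x ∈ X₀, coord α x ≠ 0} with hA
  have hAc : ¬ A.Countable := by
    intro hc
    obtain ⟨γ, hγ⟩ := exists_forall_lt hc
    refine hX (isSeparable_of_coord_eq_zero (γ := γ) fun x hx ξ hξ => ?_)
    by_contra hne
    exact absurd (hγ ξ ⟨x, hx, hne⟩) (not_lt.2 hξ)
  have : ∀ α, ∃ x, α ∈ A → x ∈ X₀ ∧ coord α x = 1 := by
    intro α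
    by_cases hα : α ∈ A
    · obtain ⟨x, hx, hne⟩ := hα
      refine ⟨(coord α x)⁻¹ • x, fun _ => ⟨X₀.smul_mem _ hx, ?_⟩⟩
      rw [map_smul, smul_eq_mul, inv_mul_cancel₀ hne]
    · exact ⟨0, fun h => (hα h).elim⟩
  choose x hx using this
  obtain ⟨n, -, hn⟩ := exists_not_countable_fiber hAc (countable_univ (α := ℕ))
    (fun α => ⌈‖x α‖⌉₊) fun _ _ => mem_univ _
  refine ⟨n, _, x, Nat.cast_nonneg n, hn, fun α hα => ⟨(hx α hα.1).1, (hx α hα.1).2, ?_⟩⟩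
  have := Nat.le_ceil ‖x α‖
  rwa [hα.2] at this

theorem exists_almost_supported {X₀ : Submodule ℝ Space}
    (hX : ¬ TopologicalSpace.IsSeparable (X₀ : Set Space)) :
    ∃ M : ℝ, 0 ≤ M ∧ ∀ γ δ, 0 < δ → ∃ x ∈ X₀, ∃ α, γ ≤ α ∧ coord α x = 1 ∧ ‖x‖ ≤ M ∧
      ‖proj γ x‖ ≤ δ := by
  obtain ⟨M, A, x, hM, hA, hx⟩ := exists_bounded_family hX
  refine ⟨4 * M, by positivity, fun γ δ hδ => ?_⟩
  obtain ⟨D, hD, hsub⟩ := isSeparable_range_proj γ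
  have : ∀ α, ∃ d ∈ D, dist (proj γ (x α)) d < δ / 4 := fun α =>
    Metric.mem_closure_iff.1 (hsub (mem_range_self (x α))) _ (by positivity)
  choose d hdD hd using this
  obtain ⟨c, -, hc⟩ := exists_not_countable_fiber hA hD d fun α _ => hdD α
  obtain ⟨β, hβ⟩ : {a ∈ A | d a = c}.Nonempty := by
    rw [nonempty_iff_ne_empty]
    intro h
    exact hc (h ▸ countable_empty)
  have hfin := finite_abs_coord_gt (x β) (by norm_num : (0 : ℝ) < 1 / 2)
  have hc' : ¬ ({a ∈ A | d a = c} \ {ξ | 1 / 2 < |coord ξ (x β)|}).Countable := fun h =>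
    hc ((h.union hfin.countable).mono fun ξ hξ => by
      by_cases h' : ξ ∈ {ξ | 1 / 2 < |coord ξ (x β)|}
      · exact Or.inr h'
      · exact Or.inl ⟨hξ, h'⟩)
  obtain ⟨α, ⟨hαA, hα⟩, hγα⟩ := exists_not_lt_of_uncountable hc' γ
  have hα2 : |coord α (x β)| ≤ 1 / 2 := not_lt.1 hα
  have hr : 1 / 2 ≤ 1 - coord α (x β) := by linarith [le_abs_self (coord α (x β))]
  have hr0 : 0 < 1 - coord α (x β) := by linarith
  have hr1 : (1 - coord α (x β))⁻¹ ≤ 2 := by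
    rw [inv_le_comm₀ hr0 (by norm_num)]
    linarith
  obtain ⟨h1, h2, h3⟩ := hx α hαA.1
  obtain ⟨h1', h2', h3'⟩ := hx β hβ.1
  refine ⟨(1 - coord α (x β))⁻¹ • (x α - x β), X₀.smul_mem _ (X₀.sub_mem h1 h1'), α, hγα,
    ?_, ?_, ?_⟩
  · rw [map_smul, map_sub, h2, smul_eq_mul, inv_mul_cancel₀ hr0.ne']
  · rw [norm_smul, Real.norm_of_nonneg (inv_nonneg.2 hr0.le)]
    have := norm_sub_le (x α) (x β)
    nlinarith [norm_nonneg (x α - x β)]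
  · rw [map_smul, map_sub, norm_smul, Real.norm_of_nonneg (inv_nonneg.2 hr0.le)]
    have h4 := hd α
    have h5 := hd β
    rw [hαA.2] at h4
    rw [hβ.2] at h5
    have h6 := dist_triangle_right (proj γ (x α)) (proj γ (x β)) c
    rw [dist_eq_norm] at h6
    nlinarith [norm_nonneg (proj γ (x α) - proj γ (x β))]

/-- A finitely supported vector `u` close to `X₀`, with support in `a` and coordinate `1` at
`α`. -/
structure IsBlock (X₀ : Submodule ℝ Space) (M δ : ℝ) (u : Space) (a : Finset Idx) (α : Idx) :
    Prop where
  mem : α ∈ a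
  coord_eq_one : coord α u = 1
  coord_eq_zero : ∀ ξ, ξ ∉ a → coord ξ u = 0
  norm_le : ‖u‖ ≤ M
  exists_close : ∃ x ∈ X₀, ‖u - x‖ ≤ δ

theorem IsBlock.mono {X₀ : Submodule ℝ Space} {M M' δ : ℝ} {u : Space} {a : Finset Idx} {α : Idx}
    (h : IsBlock X₀ M δ u a α) (hM : M ≤ M') : IsBlock X₀ M' δ u a α :=
  ⟨h.mem, h.coord_eq_one, h.coord_eq_zero, h.norm_le.trans hM, h.exists_close⟩

theorem exists_isBlock {X₀ : Submodule ℝ Space}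
    (hX : ¬ TopologicalSpace.IsSeparable (X₀ : Set Space)) :
    ∃ M : ℝ, 0 ≤ M ∧ ∀ γ δ, 0 < δ → ∃ u a α, IsBlock X₀ M δ u a α ∧ ∀ ξ ∈ a, γ ≤ ξ := by
  obtain ⟨M, hM, h⟩ := exists_almost_supported hX
  refine ⟨2 * (M + 2), by positivity, fun γ δ hδ => ?_⟩
  set ε := min (1 / 2) (δ / 6) with hε
  have hε0 : 0 < ε := lt_min (by norm_num) (by positivity)
  have hε1 : ε ≤ 1 / 2 := min_le_left _ _
  have hε2 : ε ≤ δ / 6 := min_le_right _ _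
  obtain ⟨x, hx, α, hγα, hα, hxM, hxγ⟩ := h γ ε hε0
  obtain ⟨v, hv, hxv⟩ := exists_mem_span_norm_sub_lt x hε0
  set w : Space := v - proj γ v with hw
  have hwx : ‖w - x‖ ≤ 3 * ε := by
    have h1 : w - x = -(x - v) + proj γ (x - v) - proj γ x := by
      rw [hw, map_sub]
      abel
    rw [h1]
    have h2 := norm_sub_le (-(x - v) + proj γ (x - v)) (proj γ x)
    have h3 := norm_add_le (-(x - v)) (proj γ (x - v))
    have h4 := norm_proj_le γ (x - v)
    rw [norm_neg] at h3
    linarith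
  have hcw : ∀ ξ, coord ξ w = if ξ < γ then 0 else coord ξ v := fun ξ => by
    rw [hw, map_sub, coord_proj]
    split_ifs <;> simp
  have hcα : coord α w = coord α v := by rw [hcw, if_neg (not_lt.2 hγα)]
  have hc : 1 / 2 ≤ coord α w := by
    have h1 := (abs_coord_le α (x - v)).trans hxv.le
    rw [map_sub, hα, ← hcα] at h1
    linarith [le_abs_self (1 - coord α w)]
  have hc0 : 0 < coord α w := by linarith
  have hc1 : (coord α w)⁻¹ ≤ 2 := by
    rw [inv_le_comm₀ hc0 (by norm_num)]
    linarith
  have hfin : {ξ | coord ξ w ≠ 0}.Finite := (finite_support hv).subset fun ξ hξ h0 => hξ (by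
    rw [hcw, h0, ite_self])
  refine ⟨(coord α w)⁻¹ • w, hfin.toFinset, α, ⟨?_, ?_, ?_, ?_, ?_⟩, ?_⟩
  · exact hfin.mem_toFinset.2 hc0.ne'
  · rw [map_smul, smul_eq_mul, inv_mul_cancel₀ hc0.ne']
  · intro ξ hξ
    have : coord ξ w = 0 := by
      by_contra hne
      exact hξ (hfin.mem_toFinset.2 hne)
    rw [map_smul, this, smul_zero]
  · rw [norm_smul, Real.norm_of_nonneg (inv_nonneg.2 hc0.le)]
    have := norm_sub_norm_le w x
    nlinarith [norm_nonneg w]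
  · refine ⟨(coord α w)⁻¹ • x, X₀.smul_mem _ hx, ?_⟩
    rw [← smul_sub, norm_smul, Real.norm_of_nonneg (inv_nonneg.2 hc0.le)]
    nlinarith [norm_nonneg (w - x)]
  · intro ξ hξ
    have : coord ξ w ≠ 0 := hfin.mem_toFinset.1 hξ
    by_contra hlt
    exact this (by rw [hcw, if_pos (not_le.1 hlt)])

theorem exists_isBlock_isClose {X₀ : Submodule ℝ Space} {M δ : ℝ}
    (h : ∀ γ, ∃ u a α, IsBlock X₀ M δ u a α ∧ ∀ ξ ∈ a, γ ≤ ξ) :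
    ∃ R, ∀ γ, ∃ u a α, IsBlock X₀ M δ u a α ∧ IsClose R (a : Set Idx) ∧ ∀ ξ ∈ a, γ ≤ ξ := by
  by_contra! hcon
  choose g hg using hcon
  obtain ⟨γ, hγ⟩ := exists_forall_lt (countable_range g)
  obtain ⟨u, a, α, hb, ha⟩ := h γ
  obtain ⟨R, hR⟩ := exists_isClose a.finite_toSet
  obtain ⟨ξ, hξ, hlt⟩ := hg R u a α hb hR
  exact absurd (hlt.trans (hγ _ (mem_range_self R))) (not_lt.2 (ha ξ hξ))

/-! ### Separation -/

theorem exists_separation_aux (C : Finset Idx → Prop)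
    (hC : ∀ γ, ∃ b, C b ∧ ∀ η ∈ b, γ ≤ η) (R : ℕ) :
    ∃ γ₀, ∀ W : Finset Idx, (∀ ξ ∈ W, γ₀ ≤ ξ) → ∀ γ, ∃ b, C b ∧ (∀ η ∈ b, γ ≤ η) ∧
      ∀ ξ ∈ W, ∀ η ∈ b, ξ ∉ ball R η := by
  by_contra! hcon
  choose W hW g hg using hcon
  have hnext : ∀ γ, ∃ γ', ∀ ξ ∈ W γ, ξ < γ' := fun γ =>
    exists_forall_lt (W γ).countable_toSet
  choose next hnext using hnext
  obtain ⟨γ₁⟩ : Nonempty Idx := inferInstance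
  set c : ℕ → Idx := fun n => next^[n] γ₁ with hc
  have hcs : ∀ n, c (n + 1) = next (c n) := fun n => Function.iterate_succ_apply' _ _ _
  obtain ⟨G, hG⟩ := exists_forall_lt (countable_range fun n => g (c n))
  obtain ⟨b, hb, hGb⟩ := hC G
  have : ∀ n, ∃ ξ ∈ W (c n), ∃ η ∈ b, ξ ∈ ball R η := fun n =>
    hg (c n) b hb fun η hη => (hG _ (mem_range_self n)).le.trans (hGb η hη)
  choose ξ hξ η hη hball using this
  have hmono : StrictMono ξ := strictMono_nat_of_lt_succ fun n =>
    (hnext (c n) (ξ n) (hξ n)).trans_le (hcs n ▸ hW (c (n + 1)) (ξ (n + 1)) (hξ (n + 1)))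
  classical
  refine infinite_range_of_injective hmono.injective
    ((b.biUnion fun η => ball R η).finite_toSet.subset ?_)
  rintro _ ⟨n, rfl⟩
  exact Finset.mem_coe.2 (Finset.mem_biUnion.2 ⟨η n, hη n, hball n⟩)

theorem exists_separation {ι : Type} [Countable ι] (C : ι → Finset Idx → Prop)
    (hC : ∀ i γ, ∃ b, C i b ∧ ∀ η ∈ b, γ ≤ η) :
    ∃ γ₀, ∀ W : Finset Idx, (∀ ξ ∈ W, γ₀ ≤ ξ) → ∀ i R γ, ∃ b, C i b ∧ (∀ η ∈ b, γ ≤ η) ∧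
      ∀ ξ ∈ W, ∀ η ∈ b, ξ ∉ ball R η := by
  choose g hg using fun q : ι × ℕ => exists_separation_aux (C q.1) (hC q.1) q.2
  obtain ⟨γ₀, hγ₀⟩ := exists_forall_lt (countable_range g)
  refine ⟨γ₀, fun W hW i R => hg (i, R) W fun ξ hξ => ?_⟩
  exact (hγ₀ _ (mem_range_self (i, R))).le.trans (hW ξ hξ)

/-- A family of blocks is separated above `γ₀`: one finds in it blocks arbitrarily far from a given
finite set above `γ₀`. Here `R` bounds the diameter of the blocks. -/
def IsSeparated (γ₀ : Idx) (X₀ : Submodule ℝ Space) (M δ : ℝ) (R : ℕ) : Prop :=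
  ∀ W : Finset Idx, (∀ ξ ∈ W, γ₀ ≤ ξ) → ∀ (R' : ℕ) γ, ∃ u a α, IsBlock X₀ M δ u a α ∧
    IsClose R (a : Set Idx) ∧ (∀ η ∈ a, γ ≤ η) ∧ ∀ ξ ∈ W, ∀ η ∈ a, ξ ∉ ball R' η

theorem exists_isSeparated {ι : Type} [Countable ι] (X₀ : ι → Submodule ℝ Space)
    {M : ℝ}
    (hM : ∀ i γ δ, 0 < δ → ∃ u a α, IsBlock (X₀ i) M δ u a α ∧ ∀ ξ ∈ a, γ ≤ ξ)
    (δ : ℕ → ℝ) (hδ : ∀ j, 0 < δ j) :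
    ∃ γ₀, ∀ j i, ∃ R, IsSeparated γ₀ (X₀ i) M (δ j) R := by
  choose R hR using fun q : ℕ × ι =>
    exists_isBlock_isClose (X₀ := X₀ q.2) fun γ => hM q.2 γ (δ q.1) (hδ q.1)
  obtain ⟨γ₀, hγ₀⟩ := exists_separation
    (fun (q : ℕ × ι) a => ∃ u α, IsBlock (X₀ q.2) M (δ q.1) u a α ∧ IsClose (R q) (a : Set Idx))
    fun q γ => by
      obtain ⟨u, a, α, h1, h2, h3⟩ := hR q γ
      exact ⟨a, ⟨u, α, h1, h2⟩, h3⟩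
  refine ⟨γ₀, fun j i => ⟨R (j, i), fun W hW R' γ => ?_⟩⟩
  obtain ⟨a, ⟨u, α, h1, h2⟩, h3, h4⟩ := hγ₀ W hW (j, i) R' γ
  exact ⟨u, a, α, h1, h2, h3, h4⟩

/-! ### Spread sequences of blocks -/

theorem IsIncreasing.insert {S : Set Idx} (hS : IsIncreasing S) {α : Idx} (hα : ∀ ξ ∈ S, ξ < α)
    {R : ℕ} (hR : IsClose R S) (hb : ∀ ξ ∈ S, ξ ∉ ball R α) : IsIncreasing (insert α S) := by
  intro x hx y hy z hz hxy hyz n hn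
  have hyS : y ∈ S := by
    rcases hy with rfl | hy
    · rcases hz with rfl | hz
      · exact absurd hyz (lt_irrefl _)
      · exact absurd (hyz.trans (hα z hz)) (lt_irrefl _)
    · exact hy
  have hxS : x ∈ S := by
    rcases hx with rfl | hx
    · exact absurd (hxy.trans (hα y hyS)) (lt_irrefl _)
    · exact hx
  rcases hz with rfl | hz
  · have hRn : R ≤ n := by
      by_contra hlt
      exact hb y hyS (ball_mono z (not_le.1 hlt).le hn)
    exact ball_mono y hRn (hR x hxS y hyS hxy.le)
  · exact hS x hxS y hyS z hz hxy hyz n hn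

theorem IsSeparated.exists_step {γ₀ : Idx} {X₀ : Submodule ℝ Space} {M δ : ℝ} {R : ℕ}
    (h : IsSeparated γ₀ X₀ M δ R) (V : Finset Idx) (hV : ∀ ξ ∈ V, γ₀ ≤ ξ) :
    ∃ u a α R', IsBlock X₀ M δ u a α ∧ IsClose R (a : Set Idx) ∧ (∀ η ∈ a, γ₀ ≤ η) ∧
      (∀ ξ ∈ V, ∀ η ∈ a, ξ < η) ∧ R ≤ R' ∧ IsClose R' (V : Set Idx) ∧
      ∀ ξ ∈ V, ∀ η ∈ a, ξ ∉ ball R' η := by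
  obtain ⟨R', hR'⟩ := exists_isClose V.finite_toSet
  obtain ⟨γ, hγ⟩ := exists_forall_lt V.countable_toSet
  obtain ⟨u, a, α, h1, h2, h3, h4⟩ := h V hV (max R R') (max γ₀ γ)
  exact ⟨u, a, α, max R R', h1, h2, fun η hη => (le_max_left _ _).trans (h3 η hη),
    fun ξ hξ η hη => (hγ ξ hξ).trans_le ((le_max_right _ _).trans (h3 η hη)), le_max_left _ _,
    hR'.mono_radius (le_max_right _ _), h4⟩

/-- A sequence of blocks, above a finite set `W`, which is spread with respect to the balls. -/
structure IsSpread (W : Finset Idx) (X₀ : Submodule ℝ Space) (M δ : ℝ) (u : ℕ → Space)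
    (a : ℕ → Finset Idx) (α : ℕ → Idx) : Prop where
  isBlock : ∀ k, IsBlock X₀ M δ (u k) (a k) (α k)
  lt_of_mem : ∀ k, ∀ ξ ∈ W, ∀ η ∈ a k, ξ < η
  lt : ∀ k l, k < l → ∀ ξ ∈ a k, ∀ η ∈ a l, ξ < η
  isIncreasing : ∀ E : Set Idx, E ⊆ W → IsIncreasing E → ∀ k, IsIncreasing (α '' Iio k ∪ E)
  subsingleton : ∀ S, IsIncreasing S → ∀ k l, k < l → (S ∩ a k).Nonempty →
    (S ∩ a l).Subsingleton

theorem IsSeparated.exists_isSpread {γ₀ : Idx} {X₀ : Submodule ℝ Space} {M δ : ℝ} {R : ℕ}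
    (h : IsSeparated γ₀ X₀ M δ R) (W : Finset Idx) (hW : ∀ ξ ∈ W, γ₀ ≤ ξ) :
    ∃ u a α, IsSpread W X₀ M δ u a α ∧ ∀ k, ∀ η ∈ a k, γ₀ ≤ η := by
  choose u a α R' h1 h2 h3 h4 h5 h6 h7 using
    fun V : {V : Finset Idx // ∀ ξ ∈ V, γ₀ ≤ ξ} => h.exists_step V.1 V.2
  let next : {V : Finset Idx // ∀ ξ ∈ V, γ₀ ≤ ξ} → {V : Finset Idx // ∀ ξ ∈ V, γ₀ ≤ ξ} :=
    fun V => ⟨V.1 ∪ a V, fun ξ hξ => (Finset.mem_union.1 hξ).elim (V.2 ξ) (h3 V ξ)⟩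
  let V : ℕ → {V : Finset Idx // ∀ ξ ∈ V, γ₀ ≤ ξ} := fun k => next^[k] ⟨W, hW⟩
  have hVs : ∀ k, (V (k + 1)).1 = (V k).1 ∪ a (V k) := fun k =>
    congrArg Subtype.val (Function.iterate_succ_apply' next k ⟨W, hW⟩)
  have hmono : Monotone fun k => (V k).1 := monotone_nat_of_le_succ fun k => by
    rw [hVs]
    exact Finset.subset_union_left
  have hWV : ∀ k, W ⊆ (V k).1 := fun k => hmono (Nat.zero_le k)
  have haV : ∀ k l, k < l → a (V k) ⊆ (V l).1 := fun k l hkl =>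
    (by rw [hVs]; exact Finset.subset_union_right : a (V k) ⊆ (V (k + 1)).1).trans
      (hmono (Nat.succ_le_of_lt hkl))
  refine ⟨fun k => u (V k), fun k => a (V k), fun k => α (V k), ⟨fun k => h1 (V k), ?_, ?_, ?_, ?_⟩,
    fun k => h3 (V k)⟩
  · exact fun k ξ hξ η hη => h4 (V k) ξ (hWV k hξ) η hη
  · exact fun k l hkl ξ hξ η hη => h4 (V l) ξ (haV k l hkl hξ) η hη
  · intro E hEW hE k
    induction k with
    | zero => simpa using hE
    | succ k ih =>
      have hsub : (fun k => α (V k)) '' Iio k ∪ E ⊆ (V k).1 := by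
        rintro ξ (⟨l, hl, rfl⟩ | hξ)
        · exact haV l k hl (h1 (V l)).mem
        · exact hWV k (hEW hξ)
      have heq : (fun k => α (V k)) '' Iio (k + 1) ∪ E =
          insert (α (V k)) ((fun k => α (V k)) '' Iio k ∪ E) := by
        rw [← Order.succ_eq_add_one, Order.Iio_succ_eq_insert, image_insert_eq, insert_union]
      rw [heq]
      exact ih.insert (fun ξ hξ => h4 (V k) ξ (hsub hξ) _ (h1 (V k)).mem)
        ((h6 (V k)).mono hsub) fun ξ hξ => h7 (V k) ξ (hsub hξ) _ (h1 (V k)).mem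
  · rintro S hS k l hkl ⟨η, hη, hηa⟩
    have key : ∀ ξ ∈ S ∩ a (V l), ∀ ξ' ∈ S ∩ a (V l), ¬ ξ < ξ' := by
      rintro ξ ⟨hξ, hξa⟩ ξ' ⟨hξ', hξa'⟩ hlt
      have hηV := haV k l hkl hηa
      have := hS η hη ξ hξ ξ' hξ' (h4 (V l) η hηV ξ hξa) hlt R
        (h2 (V l) ξ hξa ξ' hξa' hlt.le)
      exact h7 (V l) η hηV ξ hξa (ball_mono ξ (h5 (V l)) this)
    exact fun ξ hξ ξ' hξ' => le_antisymm (not_lt.1 (key ξ' hξ' ξ hξ)) (not_lt.1 (key ξ hξ ξ' hξ'))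

/-! ### Averages of spread sequences of blocks -/

theorem evTerm_sum {ι : Type*} (s : Special) (γ : Idx) (t : ℕ) (K : Finset ι) (x : ι → Space) :
    evTerm s γ t (∑ k ∈ K, x k) = ∑ k ∈ K, evTerm s γ t (x k) := by
  simp only [evTerm, Special.term, map_sum, Finset.mul_sum]
  exact Finset.sum_comm

theorem IsBlock.evTerm_eq_zero {X₀ : Submodule ℝ Space} {M δ : ℝ} {u : Space} {a : Finset Idx}
    {α : Idx} (h : IsBlock X₀ M δ u a α) (s : Special) (γ : Idx) {t : ℕ}
    (hd : ¬ ((s.set t : Set Idx) ∩ a).Nonempty) : evTerm s γ t u = 0 := by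
  rw [evTerm, Special.term, Finset.sum_eq_zero, mul_zero]
  intro ξ hξ
  exact h.coord_eq_zero ξ fun hξa => hd ⟨ξ, (Finset.mem_filter.1 hξ).1, hξa⟩

theorem IsBlock.abs_evTerm_le {X₀ : Submodule ℝ Space} {M δ : ℝ} {u : Space} {a : Finset Idx}
    {α : Idx} (h : IsBlock X₀ M δ u a α) (s : Special) (γ : Idx) {t : ℕ}
    (hd : ((s.set t : Set Idx) ∩ a).Subsingleton) :
    |evTerm s γ t u| ≤ (mw (s.wt t))⁻¹ * M := by
  have hM : 0 ≤ M := (norm_nonneg _).trans h.norm_le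
  rw [evTerm, Special.term, abs_mul, abs_of_pos (inv_pos.2 (mw_pos _))]
  refine mul_le_mul_of_nonneg_left ?_ (inv_pos.2 (mw_pos _)).le
  rw [← Finset.sum_filter_of_ne (p := (· ∈ a)) fun ξ _ hξ => by
    by_contra hξa
    exact hξ (h.coord_eq_zero ξ hξa)]
  have hcard : (((s.set t).filter (· < γ)).filter (· ∈ a)).card ≤ 1 :=
    Finset.card_le_one.2 fun ξ hξ η hη => by
      simp only [Finset.mem_filter] at hξ hη
      exact hd ⟨hξ.1.1, hξ.2⟩ ⟨hη.1.1, hη.2⟩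
  refine (Finset.abs_sum_le_sum_abs _ _).trans ((Finset.sum_le_card_nsmul _ _ M fun ξ _ =>
    (abs_coord_le ξ u).trans h.norm_le).trans ?_)
  rw [nsmul_eq_mul]
  exact mul_le_of_le_one_left hM (by exact_mod_cast hcard)

theorem abs_evTerm_sum_le {X₀ : Submodule ℝ Space} {M δ : ℝ} {u : ℕ → Space} {a : ℕ → Finset Idx}
    {α : ℕ → Idx} (h : ∀ k, IsBlock X₀ M δ (u k) (a k) (α k))
    (hdisj : ∀ k l ξ, ξ ∈ a k → ξ ∈ a l → k = l) (s : Special) (γ : Idx) {t : ℕ} (ht : t < s.len)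
    (K : Finset ℕ) (hK : ∀ k ∈ K, ((s.set t : Set Idx) ∩ a k).Subsingleton) :
    |evTerm s γ t (∑ k ∈ K, u k)| ≤ min (K.card : ℝ) (nw (s.wt t)) * ((mw (s.wt t))⁻¹ * M) := by
  classical
  have hM : 0 ≤ M := (norm_nonneg _).trans (h 0).norm_le
  set K' := K.filter fun k => ((s.set t : Set Idx) ∩ a k).Nonempty with hK'
  have hsum : ∑ k ∈ K', evTerm s γ t (u k) = ∑ k ∈ K, evTerm s γ t (u k) :=
    Finset.sum_filter_of_ne fun k _ hk => by
      by_contra hne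
      exact hk ((h k).evTerm_eq_zero s γ hne)
  have hcard1 : K'.card ≤ K.card := Finset.card_filter_le _ _
  have hcard2 : K'.card ≤ nw (s.wt t) := by
    refine le_trans ?_ (s.card_le t ht)
    choose! f hf using fun k (hk : k ∈ K') => (Finset.mem_filter.1 hk).2
    exact Finset.card_le_card_of_injOn f (fun k hk => (hf k hk).1) fun k hk l hl hkl =>
      hdisj k l (f k) (hf k hk).2 (hkl ▸ (hf l hl).2)
  rw [evTerm_sum, ← hsum]
  refine (Finset.abs_sum_le_sum_abs _ _).trans ((Finset.sum_le_card_nsmul _ _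
    ((mw (s.wt t))⁻¹ * M) fun k hk => (h k).abs_evTerm_le s γ
      (hK k (Finset.mem_filter.1 hk).1)).trans ?_)
  rw [nsmul_eq_mul]
  exact mul_le_mul_of_nonneg_right (le_min (Nat.cast_le.2 hcard1) (Nat.cast_le.2 hcard2))
    (mul_nonneg (inv_pos.2 (mw_pos _)).le hM)

/-- The terms of a special functional whose weight is `j`. -/
noncomputable def matching (s : Special) (j : ℕ) : Finset ℕ :=
  (Finset.range s.len).filter fun t => s.wt t = j

theorem mem_matching {s : Special} {j t : ℕ} : t ∈ matching s j ↔ t < s.len ∧ s.wt t = j := by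
  rw [matching, Finset.mem_filter, Finset.mem_range]

theorem card_matching_le_one (s : Special) (j : ℕ) : (matching s j).card ≤ 1 :=
  Finset.card_le_one.2 fun t ht t' ht' => by
    rw [mem_matching] at ht ht'
    exact s.wt_inj ht.1 ht'.1 (ht.2.trans ht'.2.symm)

theorem abs_sum_matching_le (s : Special) (j : ℕ) {f : ℕ → ℝ} {b : ℝ} (hb : 0 ≤ b)
    (h : ∀ t ∈ matching s j, |f t| ≤ b) : |∑ t ∈ matching s j, f t| ≤ b := by
  refine (Finset.abs_sum_le_sum_abs _ _).trans ((Finset.sum_le_card_nsmul _ _ b h).trans ?_)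
  rw [nsmul_eq_mul]
  exact mul_le_of_le_one_left hb (by exact_mod_cast card_matching_le_one s j)

theorem sum_two_inv_pow_wt_le (s : Special) :
    ∑ t ∈ Finset.range s.len, (1 / 2 : ℝ) ^ s.wt t ≤ 2 := by
  refine le_trans (Finset.sum_le_sum fun t ht => ?_) (sum_geometric_two_le s.len)
  have := s.wt_zero_add_le (Finset.mem_range.1 ht)
  exact pow_le_pow_of_le_one (by norm_num) (by norm_num) (by omega)

/-- A vector which behaves under special functionals like the average, with weight `j`, of the
unit vectors of `F`. -/
structure IsAverage (M : ℝ) (z : Space) (j : ℕ) (F A : Finset Idx) : Prop where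
  coord_eq_zero : ∀ ξ, ξ ∉ A → coord ξ z = 0
  subset : F ⊆ A
  card_eq : F.card = nw j
  coord_eq : ∀ ξ ∈ F, coord ξ z = mw j / nw j
  abs_ev_sub_le : ∀ s γ, |ev s γ z - ∑ t ∈ matching s j, evTerm s γ t z| ≤ 4 * M * (1 / 2) ^ j
  abs_evTerm_le : ∀ s γ, ∀ t ∈ matching s j, |evTerm s γ t z| ≤ 2 * M

section Average

variable {W : Finset Idx} {X₀ : Submodule ℝ Space} {M δ : ℝ} {u : ℕ → Space} {a : ℕ → Finset Idx}
  {α : ℕ → Idx}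

theorem IsSpread.eq_of_mem (h : IsSpread W X₀ M δ u a α) (k l : ℕ) (ξ : Idx) (hk : ξ ∈ a k)
    (hl : ξ ∈ a l) : k = l := by
  by_contra hne
  rcases lt_or_gt_of_ne hne with hlt | hlt
  · exact lt_irrefl _ (h.lt k l hlt ξ hk ξ hl)
  · exact lt_irrefl _ (h.lt l k hlt ξ hl ξ hk)

theorem IsSpread.strictMono (h : IsSpread W X₀ M δ u a α) : StrictMono α := fun k l hkl =>
  h.lt k l hkl _ (h.isBlock k).mem _ (h.isBlock l).mem

/-- The average of a sequence of vectors. -/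
noncomputable def average (j : ℕ) (u : ℕ → Space) : Space :=
  (mw j / nw j) • ∑ k ∈ Finset.range (nw j), u k

theorem IsSpread.exists_decomposition (h : IsSpread W X₀ M δ u a α) (j : ℕ) (s : Special) :
    ∃ y e : Space, average j u = y + e ∧ ‖e‖ ≤ M * (1 / 2) ^ j ∧
      (∀ γ, ∀ t < s.len, s.wt t ≠ j → |evTerm s γ t y| ≤ M * (1 / 2) ^ j * (1 / 2) ^ s.wt t) ∧
      ∀ γ, ∀ t < s.len, s.wt t = j → |evTerm s γ t y| ≤ M := by
  classical
  have hM : 0 ≤ M := (norm_nonneg _).trans (h.isBlock 0).norm_le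
  have hc : 0 < mw j / nw j := div_pos (mw_pos j) (cast_nw_pos j)
  set S : Set Idx := {ξ | ∃ t < s.len, ξ ∈ s.set t} with hS
  set K := (Finset.range (nw j)).filter fun k => (S ∩ a k).Subsingleton with hK
  set B := (Finset.range (nw j)).filter fun k => ¬ (S ∩ a k).Subsingleton with hB
  have hBcard : B.card ≤ 1 := Finset.card_le_one.2 fun k hk l hl => by
    have key : ∀ k ∈ B, ∀ l ∈ B, ¬ k < l := fun k hk l hl hkl => by
      refine (Finset.mem_filter.1 hl).2 (h.subsingleton S s.incr k l hkl ?_)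
      by_contra hne
      refine (Finset.mem_filter.1 hk).2 ?_
      rw [not_nonempty_iff_eq_empty.1 hne]
      exact subsingleton_empty
    have h1 := key k hk l hl
    have h2 := key l hl k hk
    omega
  have hKcard : K.card ≤ nw j := (Finset.card_filter_le _ _).trans (Finset.card_range _).le
  have hKterm : ∀ γ, ∀ t < s.len, |evTerm s γ t ((mw j / nw j) • ∑ k ∈ K, u k)| ≤
      mw j / nw j * (min (nw j : ℝ) (nw (s.wt t)) * ((mw (s.wt t))⁻¹ * M)) := by
    intro γ t ht
    rw [evTerm_smul, abs_mul, abs_of_pos hc]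
    refine mul_le_mul_of_nonneg_left ((abs_evTerm_sum_le h.isBlock h.eq_of_mem s γ ht K
      fun k hk => ((Finset.mem_filter.1 hk).2).anti ?_).trans ?_) hc.le
    · exact fun ξ hξ => ⟨⟨t, ht, hξ.1⟩, hξ.2⟩
    · refine mul_le_mul_of_nonneg_right (min_le_min_right _ (by exact_mod_cast hKcard))
        (mul_nonneg (inv_pos.2 (mw_pos _)).le hM)
  refine ⟨(mw j / nw j) • ∑ k ∈ K, u k, (mw j / nw j) • ∑ k ∈ B, u k, ?_, ?_, ?_, ?_⟩
  · rw [average, ← smul_add, hK, hB, Finset.sum_filter_add_sum_filter_not]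
  · rw [norm_smul, Real.norm_of_nonneg hc.le, mul_comm M]
    refine mul_le_mul (mw_div_nw_le j) ?_ (norm_nonneg _) (by positivity)
    refine (norm_sum_le _ _).trans ((Finset.sum_le_card_nsmul _ _ M fun k _ =>
      (h.isBlock k).norm_le).trans ?_)
    rw [nsmul_eq_mul]
    exact mul_le_of_le_one_left hM (by exact_mod_cast hBcard)
  · intro γ t ht hne
    refine (hKterm γ t ht).trans ?_
    have h1 := min_nw_mul_le hne
    have h2 := cast_nw_pos j
    have h3 := mw_pos (s.wt t)
    have h4 : mw j / nw j * (min (nw j : ℝ) (nw (s.wt t)) * ((mw (s.wt t))⁻¹ * M)) =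
        M * ((min (nw j : ℝ) (nw (s.wt t)) * mw j) / (nw j * mw (s.wt t))) := by
      field_simp
    rw [h4, mul_assoc, ← pow_add]
    exact mul_le_mul_of_nonneg_left ((div_le_iff₀ (by positivity)).2 h1) hM
  · intro γ t ht he
    refine (hKterm γ t ht).trans ?_
    have h2 := cast_nw_pos j
    have h3 := mw_pos j
    rw [he, min_self]
    apply le_of_eq
    field_simp

theorem IsSpread.isAverage (h : IsSpread W X₀ M δ u a α) (j : ℕ) :
    IsAverage M (average j u) j ((Finset.range (nw j)).image α)
      ((Finset.range (nw j)).biUnion a) := by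
  classical
  have hM : 0 ≤ M := (norm_nonneg _).trans (h.isBlock 0).norm_le
  have hpow : M * (1 / 2 : ℝ) ^ j ≤ M :=
    mul_le_of_le_one_right hM (pow_le_one₀ (by norm_num) (by norm_num))
  refine ⟨?_, ?_, ?_, ?_, ?_, ?_⟩
  · intro ξ hξ
    rw [average, map_smul, map_sum, Finset.sum_eq_zero, smul_zero]
    exact fun k hk => (h.isBlock k).coord_eq_zero ξ fun hξk =>
      hξ (Finset.mem_biUnion.2 ⟨k, hk, hξk⟩)
  · intro ξ hξ
    obtain ⟨k, hk, rfl⟩ := Finset.mem_image.1 hξ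
    exact Finset.mem_biUnion.2 ⟨k, hk, (h.isBlock k).mem⟩
  · rw [Finset.card_image_of_injective _ h.strictMono.injective, Finset.card_range]
  · intro ξ hξ
    obtain ⟨k, hk, rfl⟩ := Finset.mem_image.1 hξ
    rw [average, map_smul, map_sum, Finset.sum_eq_single_of_mem k hk, (h.isBlock k).coord_eq_one,
      smul_eq_mul, mul_one]
    exact fun l _ hl => (h.isBlock l).coord_eq_zero _ fun hmem =>
      hl (h.eq_of_mem l k _ hmem (h.isBlock k).mem)
  · intro s γ
    obtain ⟨y, e, hye, he, h1, -⟩ := h.exists_decomposition j s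
    have hsplit : ∀ x, ev s γ x = ∑ t ∈ matching s j, evTerm s γ t x +
        ∑ t ∈ (Finset.range s.len).filter (fun t => s.wt t ≠ j), evTerm s γ t x := fun x => by
      rw [ev_eq_sum, matching, Finset.sum_filter_add_sum_filter_not]
    have h3 : |∑ t ∈ (Finset.range s.len).filter (fun t => s.wt t ≠ j), evTerm s γ t y| ≤
        M * (1 / 2) ^ j * 2 := by
      refine (Finset.abs_sum_le_sum_abs _ _).trans ((Finset.sum_le_sum fun t ht => h1 γ t
        (Finset.mem_range.1 (Finset.mem_filter.1 ht).1) (Finset.mem_filter.1 ht).2).trans ?_)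
      rw [← Finset.mul_sum]
      refine mul_le_mul_of_nonneg_left ((Finset.sum_le_sum_of_subset_of_nonneg
        (Finset.filter_subset _ _) fun _ _ _ => by positivity).trans
        (sum_two_inv_pow_wt_le s)) (by positivity)
    have h4 : |∑ t ∈ matching s j, evTerm s γ t e| ≤ M * (1 / 2) ^ j :=
      abs_sum_matching_le s j (by positivity) fun t ht =>
        (LopezAbadTodorcevic.abs_evTerm_le s γ (mem_matching.1 ht).1 e).trans he
    have h5 := (abs_ev_le s γ e).trans he
    have h6 : ev s γ (average j u) - ∑ t ∈ matching s j, evTerm s γ t (average j u) =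
        ∑ t ∈ (Finset.range s.len).filter (fun t => s.wt t ≠ j), evTerm s γ t y +
          (ev s γ e - ∑ t ∈ matching s j, evTerm s γ t e) := by
      rw [hye, map_add, hsplit y]
      simp only [evTerm_add, Finset.sum_add_distrib]
      ring
    rw [h6]
    rw [abs_le] at h3 h4 h5 ⊢
    constructor <;> linarith [h3.1, h3.2, h4.1, h4.2, h5.1, h5.2]
  · intro s γ t ht
    obtain ⟨y, e, hye, he, -, h2⟩ := h.exists_decomposition j s
    rw [mem_matching] at ht
    rw [hye, evTerm_add]
    have h3 := h2 γ t ht.1 ht.2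
    have h4 := LopezAbadTodorcevic.abs_evTerm_le s γ ht.1 e
    refine (abs_add_le _ _).trans ?_
    linarith

theorem IsSpread.exists_norm_average_sub_le (h : IsSpread W X₀ M δ u a α) (j : ℕ) :
    ∃ x ∈ X₀, ‖average j u - x‖ ≤ mw j * δ := by
  choose x hx hux using fun k => (h.isBlock k).exists_close
  refine ⟨average j x, X₀.smul_mem _ (X₀.sum_mem fun k _ => hx k), ?_⟩
  have hc : 0 < mw j / nw j := div_pos (mw_pos j) (cast_nw_pos j)
  rw [average, average, ← smul_sub, ← Finset.sum_sub_distrib, norm_smul,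
    Real.norm_of_nonneg hc.le]
  have h1 : ‖∑ k ∈ Finset.range (nw j), (u k - x k)‖ ≤ nw j * δ := by
    refine (norm_sum_le _ _).trans ((Finset.sum_le_card_nsmul _ _ δ fun k _ => hux k).trans ?_)
    rw [nsmul_eq_mul, Finset.card_range]
  refine (mul_le_mul_of_nonneg_left h1 hc.le).trans (le_of_eq ?_)
  have := cast_nw_pos j
  field_simp

end Average

/-! ### Coded sequences of averages -/

/-- A weight, together with an average of this weight, the sets carrying it, a bound for their
diameters, and a nearby vector. -/
structure Stage where
  /-- the weight -/
  wt : ℕ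
  /-- the set on which the average behaves like a sum of unit vectors -/
  set : Finset Idx
  /-- the support of the average -/
  supp : Finset Idx
  /-- the radius -/
  par : ℕ
  /-- the average -/
  vec : Space
  /-- a nearby vector -/
  approx : Space

/-- The weight dictated by the previous stages. -/
noncomputable def nextWt (j₀ : ℕ) (f : ℕ → Stage) : ℕ → ℕ
  | 0 => j₀
  | k + 1 => code (f k).par (history (f k).par (fun i => (f i).wt) (fun i => (f i).set) (k + 1))

theorem nextWt_congr {j₀ k : ℕ} {f g : ℕ → Stage} (h : ∀ i < k, f i = g i) :
    nextWt j₀ f k = nextWt j₀ g k := by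
  cases k with
  | zero => rfl
  | succ k =>
    rw [nextWt, nextWt, h k k.lt_add_one]
    exact congrArg _ (history_congr (fun i hi => by rw [h i hi]) fun i hi => by rw [h i hi])

/-- The stage `k` is compatible with the previous ones. -/
structure IsStage (γ₀ : Idx) (X : ℕ → Submodule ℝ Space) (M : ℝ) (j₀ : ℕ) (f : ℕ → Stage)
    (k : ℕ) : Prop where
  wt_eq : (f k).wt = nextWt j₀ f k
  isAverage : IsAverage M (f k).vec (f k).wt (f k).set (f k).supp
  le : ∀ ξ ∈ (f k).supp, γ₀ ≤ ξ
  lt : ∀ i < k, ∀ ξ ∈ (f i).supp, ∀ η ∈ (f k).supp, ξ < η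
  mem : (f k).approx ∈ X k
  norm_sub_le : ‖(f k).vec - (f k).approx‖ ≤ (1 / 2) ^ (f k).wt
  incr : IsIncreasing {ξ | ∃ i ≤ k, ξ ∈ (f i).set}
  close : IsClose (f k).par {ξ | ∃ i ≤ k, ξ ∈ (f i).supp}

theorem IsStage.congr {γ₀ : Idx} {X : ℕ → Submodule ℝ Space} {M : ℝ} {j₀ : ℕ} {f g : ℕ → Stage}
    {k : ℕ} (h : IsStage γ₀ X M j₀ f k) (hfg : ∀ i ≤ k, f i = g i) : IsStage γ₀ X M j₀ g k := by
  have hk := hfg k le_rfl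
  refine ⟨?_, hk ▸ h.isAverage, hk ▸ h.le, fun i hi => hk ▸ hfg i hi.le ▸ h.lt i hi, hk ▸ h.mem,
    hk ▸ h.norm_sub_le, h.incr.mono ?_, hk ▸ h.close.mono ?_⟩
  · rw [← hk, h.wt_eq]
    exact nextWt_congr fun i hi => hfg i hi.le
  · rintro ξ ⟨i, hi, hξ⟩
    exact ⟨i, hi, hfg i hi ▸ hξ⟩
  · rintro ξ ⟨i, hi, hξ⟩
    exact ⟨i, hi, hfg i hi ▸ hξ⟩

theorem exists_isStage_update {γ₀ : Idx} {X : ℕ → Submodule ℝ Space} {M : ℝ}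
    (hX : ∀ j k, ∃ R, IsSeparated γ₀ (X k) M ((1 / 2) ^ j / mw j) R) (j₀ k : ℕ) (f : ℕ → Stage)
    (hf : ∀ i < k, IsStage γ₀ X M j₀ f i) :
    ∃ σ, IsStage γ₀ X M j₀ (Function.update f k σ) k := by
  classical
  set j := nextWt j₀ f k with hj
  set V : Finset Idx := (Finset.range k).biUnion fun i => (f i).supp with hV
  have hmemV : ∀ ξ, ξ ∈ V ↔ ∃ i < k, ξ ∈ (f i).supp := fun ξ => by
    simp [hV]
  have hVγ : ∀ ξ ∈ V, γ₀ ≤ ξ := fun ξ hξ => by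
    obtain ⟨i, hi, hξi⟩ := (hmemV ξ).1 hξ
    exact (hf i hi).le ξ hξi
  obtain ⟨R, hR⟩ := hX j k
  obtain ⟨u, a, α, hs, ha⟩ := hR.exists_isSpread V hVγ
  obtain ⟨x, hx, hxd⟩ := hs.exists_norm_average_sub_le j
  set F := (Finset.range (nw j)).image α with hF
  set A := (Finset.range (nw j)).biUnion a with hA
  obtain ⟨π, hπ⟩ := exists_isClose (V ∪ A).finite_toSet
  refine ⟨⟨j, F, A, π, average j u, x⟩, ?_⟩
  set g := Function.update f k ⟨j, F, A, π, average j u, x⟩ with hg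
  have hgk : g k = ⟨j, F, A, π, average j u, x⟩ := Function.update_self _ _ _
  have hgi : ∀ i, i < k → g i = f i := fun i hi => Function.update_of_ne hi.ne _ _
  refine ⟨?_, ?_, ?_, ?_, ?_, ?_, ?_, ?_⟩
  · rw [hgk]
    exact nextWt_congr fun i hi => (hgi i hi).symm
  · rw [hgk]
    exact hs.isAverage j
  · rw [hgk]
    intro ξ hξ
    obtain ⟨l, -, hl⟩ := Finset.mem_biUnion.1 hξ
    exact ha l ξ hl
  · intro i hi ξ hξ η hη
    rw [hgi i hi] at hξ
    rw [hgk] at hη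
    obtain ⟨l, -, hl⟩ := Finset.mem_biUnion.1 hη
    exact hs.lt_of_mem l ξ ((hmemV ξ).2 ⟨i, hi, hξ⟩) η hl
  · rw [hgk]
    exact hx
  · rw [hgk]
    refine hxd.trans (le_of_eq ?_)
    have := mw_pos j
    field_simp
  · have hE : IsIncreasing {ξ | ∃ i < k, ξ ∈ (f i).set} := by
      rcases Nat.eq_zero_or_pos k with rfl | hk
      · exact isIncreasing_of_subsingleton fun ξ hξ => by
          obtain ⟨i, hi, -⟩ := hξ
          exact absurd hi (Nat.not_lt_zero i)
      · refine (hf (k - 1) (by omega)).incr.mono ?_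
        rintro ξ ⟨i, hi, hξ⟩
        exact ⟨i, by omega, hξ⟩
    refine (hs.isIncreasing _ ?_ hE (nw j)).mono ?_
    · rintro ξ ⟨i, hi, hξ⟩
      exact (hmemV ξ).2 ⟨i, hi, (hf i hi).isAverage.subset hξ⟩
    · rintro ξ ⟨i, hi, hξ⟩
      rcases hi.lt_or_eq with hi | rfl
      · exact Or.inr ⟨i, hi, hgi i hi ▸ hξ⟩
      · rw [hgk] at hξ
        obtain ⟨l, hl, rfl⟩ := Finset.mem_image.1 hξ
        exact Or.inl ⟨l, Finset.mem_range.1 hl, rfl⟩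
  · rw [hgk]
    refine hπ.mono ?_
    rintro ξ ⟨i, hi, hξ⟩
    rcases hi.lt_or_eq with hi | rfl
    · rw [hgi i hi] at hξ
      exact Finset.mem_coe.2 (Finset.mem_union_left _ ((hmemV ξ).2 ⟨i, hi, hξ⟩))
    · rw [hgk] at hξ
      exact Finset.mem_coe.2 (Finset.mem_union_right _ hξ)

theorem exists_isStage {γ₀ : Idx} {X : ℕ → Submodule ℝ Space} {M : ℝ}
    (hX : ∀ j k, ∃ R, IsSeparated γ₀ (X k) M ((1 / 2) ^ j / mw j) R) (j₀ n : ℕ) :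
    ∃ f : ℕ → Stage, ∀ i < n, IsStage γ₀ X M j₀ f i := by
  induction n with
  | zero => exact ⟨fun _ => ⟨0, ∅, ∅, 0, 0, 0⟩, fun i hi => absurd hi (Nat.not_lt_zero i)⟩
  | succ n ih =>
    obtain ⟨f, hf⟩ := ih
    obtain ⟨σ, hσ⟩ := exists_isStage_update hX j₀ n f hf
    refine ⟨Function.update f n σ, fun i hi => ?_⟩
    rcases (Nat.lt_succ_iff.1 hi).lt_or_eq with hlt | rfl
    · exact (hf i hlt).congr fun l hl => (Function.update_of_ne (by omega) _ _).symm
    · exact hσ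

/-- The special sequence given by a sequence of stages. -/
noncomputable def stageSpecial {γ₀ : Idx} {X : ℕ → Submodule ℝ Space} {M : ℝ} {j₀ n : ℕ}
    {f : ℕ → Stage} (h : ∀ i < n, IsStage γ₀ X M j₀ f i) (hn : n ≤ j₀ + 1) : Special where
  len := n
  wt i := (f i).wt
  set i := (f i).set
  par i := (f i).par
  len_le := by
    rcases Nat.eq_zero_or_pos n with rfl | hpos
    · exact Nat.zero_le _
    · rwa [(h 0 hpos).wt_eq, nextWt]
  card_le t ht := (h t ht).isAverage.card_eq.le
  incr := by
    rcases Nat.eq_zero_or_pos n with rfl | hpos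
    · exact isIncreasing_of_subsingleton fun ξ hξ => by
        obtain ⟨i, hi, -⟩ := hξ
        exact absurd hi (Nat.not_lt_zero i)
    · refine (h (n - 1) (by omega)).incr.mono ?_
      rintro ξ ⟨i, hi, hξ⟩
      exact ⟨i, by omega, hξ⟩
  close t ht := by
    refine (h t (by omega)).close.mono ?_
    rintro ξ ⟨i, hi, hξ⟩
    exact ⟨i, hi, (h i (by omega)).isAverage.subset hξ⟩
  wt_succ t ht := (h (t + 1) ht).wt_eq

/-! ### Estimates for coded sequences of averages -/

theorem evTerm_eq_zero_of_disjoint (s : Special) (γ : Idx) (t : ℕ) {z : Space}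
    (h : ∀ ξ ∈ s.set t, coord ξ z = 0) : evTerm s γ t z = 0 := by
  rw [evTerm, Special.term, Finset.sum_eq_zero, mul_zero]
  exact fun ξ hξ => h ξ (Finset.mem_filter.1 hξ).1

theorem IsAverage.evTerm_eq {M : ℝ} {z : Space} {j : ℕ} {F A : Finset Idx}
    (h : IsAverage M z j F A) (s : Special) (γ : Idx) {t : ℕ} (hw : s.wt t = j)
    (hs : ∀ ξ ∈ s.set t, ξ ∈ A → ξ ∈ F) :
    evTerm s γ t z = ((F.filter fun ξ => ξ ∈ s.set t ∧ ξ < γ).card : ℝ) / nw j := by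
  classical
  have h1 : ∑ ξ ∈ (s.set t).filter (· < γ), coord ξ z =
      ∑ ξ ∈ F.filter fun ξ => ξ ∈ s.set t ∧ ξ < γ, coord ξ z := by
    symm
    refine Finset.sum_subset (fun ξ hξ => ?_) fun ξ hξ hξF => ?_
    · simp only [Finset.mem_filter] at hξ ⊢
      exact hξ.2
    · simp only [Finset.mem_filter] at hξ hξF
      exact h.coord_eq_zero ξ fun hA => hξF ⟨hs ξ hξ.1 hA, hξ⟩
  rw [evTerm, Special.term, h1, Finset.sum_congr rfl fun ξ hξ =>
    h.coord_eq ξ (Finset.mem_filter.1 hξ).1, Finset.sum_const, nsmul_eq_mul, hw]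
  have := mw_pos j
  have := cast_nw_pos j
  field_simp

theorem abs_alternating_sum_le (n : ℕ) (t : ℕ → ℝ) (b : ℝ) (h0 : ∀ i < n, 0 ≤ t i)
    (hb : 0 ≤ b) (h1 : 0 < n → t 0 ≤ b) (h : ∀ i, i + 1 < n → t (i + 1) ≤ t i) :
    0 ≤ ∑ i ∈ Finset.range n, (-1) ^ i * t i ∧ ∑ i ∈ Finset.range n, (-1) ^ i * t i ≤ b := by
  induction n generalizing t b with
  | zero => simpa using hb
  | succ n ih =>
    obtain ⟨h2, h3⟩ := ih (fun i => t (i + 1)) (t 0) (fun i hi => h0 (i + 1) (by omega))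
      (h0 0 n.succ_pos) (fun hn => h 0 (by omega)) fun i hi => h (i + 1) (by omega)
    have h4 := h1 n.succ_pos
    have h5 : ∑ i ∈ Finset.range n, (-1 : ℝ) ^ (i + 1) * t (i + 1) =
        -∑ i ∈ Finset.range n, (-1 : ℝ) ^ i * t (i + 1) := by
      rw [← Finset.sum_neg_distrib]
      exact Finset.sum_congr rfl fun i _ => by ring
    rw [Finset.sum_range_succ', h5]
    constructor <;> simp <;> linarith

section Stages

variable {γ₀ : Idx} {X : ℕ → Submodule ℝ Space} {M : ℝ} {j₀ n : ℕ} {f : ℕ → Stage}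

theorem eq_of_mem_supp (h : ∀ i < n, IsStage γ₀ X M j₀ f i) {i k : ℕ} (hi : i < n) (hk : k < n)
    {ξ : Idx} (hξ : ξ ∈ (f i).supp) (hξ' : ξ ∈ (f k).supp) : i = k := by
  by_contra hne
  rcases lt_or_gt_of_ne hne with hlt | hlt
  · exact lt_irrefl _ ((h k hk).lt i hlt ξ hξ ξ hξ')
  · exact lt_irrefl _ ((h i hi).lt k hlt ξ hξ' ξ hξ)

theorem card_le_norm_sum (h : ∀ i < n, IsStage γ₀ X M j₀ f i) (hn : n ≤ j₀ + 1)
    {K : Finset ℕ} (hK : K ⊆ Finset.range n) : (K.card : ℝ) ≤ ‖∑ i ∈ K, (f i).vec‖ := by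
  classical
  obtain ⟨γ, hγ⟩ := exists_forall_lt
    (((Finset.range n).biUnion fun i => (f i).set).countable_toSet)
  have hev : ∀ i ∈ K, ev (stageSpecial h hn) γ (f i).vec = 1 := by
    intro i hi
    have hin := Finset.mem_range.1 (hK hi)
    rw [ev_eq_sum, Finset.sum_eq_single i]
    · rw [(h i hin).isAverage.evTerm_eq (stageSpecial h hn) γ rfl fun ξ hξ _ => hξ,
        Finset.filter_true_of_mem, (h i hin).isAverage.card_eq]
      · exact div_self (cast_nw_pos _).ne'
      · exact fun ξ hξ => ⟨hξ, hγ ξ (Finset.mem_coe.2 (Finset.mem_biUnion.2 ⟨i, hK hi, hξ⟩))⟩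
    · intro t ht hne
      refine evTerm_eq_zero_of_disjoint _ _ _ fun ξ hξ => ?_
      have htn : t < n := Finset.mem_range.1 ht
      exact (h i hin).isAverage.coord_eq_zero ξ fun hξi =>
        hne (eq_of_mem_supp h htn hin ((h t htn).isAverage.subset hξ) hξi)
    · exact fun hni => absurd (hK hi) hni
  have h1 := (le_abs_self _).trans (abs_ev_le (stageSpecial h hn) γ (∑ i ∈ K, (f i).vec))
  rw [map_sum, Finset.sum_congr rfl hev] at h1
  simpa using h1

theorem sum_two_inv_pow_stage_wt_le (h : ∀ i < n, IsStage γ₀ X M j₀ f i) (hn : n ≤ j₀ + 1) :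
    ∑ i ∈ Finset.range n, (1 / 2 : ℝ) ^ (f i).wt ≤ 2 :=
  sum_two_inv_pow_wt_le (stageSpecial h hn)

theorem stage_wt_inj (h : ∀ i < n, IsStage γ₀ X M j₀ f i) (hn : n ≤ j₀ + 1) {i k : ℕ}
    (hi : i < n) (hk : k < n) (he : (f i).wt = (f k).wt) : i = k :=
  (stageSpecial h hn).wt_inj hi hk he

/-- A special sequence sharing a weight with a sequence of stages shares its history. -/
theorem history_eq (h : ∀ i < n, IsStage γ₀ X M j₀ f i) (s : Special) {i t : ℕ} (hi : i + 1 < n)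
    (ht : t + 1 < s.len) (he : s.wt (t + 1) = (f (i + 1)).wt) :
    t = i ∧ s.par i = (f i).par ∧ ∀ k ≤ i, s.wt k = (f k).wt ∧
      (s.set k).image (height (f i).par) = (f k).set.image (height (f i).par) := by
  rw [s.wt_succ t ht, (h (i + 1) hi).wt_eq, nextWt] at he
  obtain ⟨h1, h2, h3⟩ := code_history_inj he
  obtain rfl : t = i := by omega
  exact ⟨rfl, h1, fun k hk => h1 ▸ h3 k (Nat.lt_succ_of_le hk)⟩

end Stages

/-! ### The norm of alternating sums -/

/-- The part of a functional which has the same weight as a given stage. -/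
noncomputable def matched (s : Special) (γ : Idx) (σ : Stage) : ℝ :=
  ∑ t ∈ matching s σ.wt, evTerm s γ t σ.vec

section Alternating

variable {γ₀ : Idx} {X : ℕ → Submodule ℝ Space} {M : ℝ} {j₀ n : ℕ} {f : ℕ → Stage}

theorem abs_matched_le (h : ∀ i < n, IsStage γ₀ X M j₀ f i) (hM : 0 ≤ M) (s : Special) (γ : Idx)
    {i : ℕ} (hi : i < n) : |matched s γ (f i)| ≤ 2 * M :=
  abs_sum_matching_le s _ (by positivity) ((h i hi).isAverage.abs_evTerm_le s γ)

theorem matched_eq_zero {s : Special} {γ : Idx} {σ : Stage}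
    (h : ∀ t < s.len, s.wt t ≠ σ.wt) : matched s γ σ = 0 := by
  rw [matched]
  refine Finset.sum_eq_zero fun t ht => ?_
  rw [mem_matching] at ht
  exact absurd ht.2 (h t ht.1)

theorem matched_eq_evTerm {s : Special} {γ : Idx} {σ : Stage} {t : ℕ} (ht : t < s.len)
    (hw : s.wt t = σ.wt) : matched s γ σ = evTerm s γ t σ.vec := by
  rw [matched, Finset.sum_eq_single_of_mem t (mem_matching.2 ⟨ht, hw⟩)]
  intro t' ht' hne
  rw [mem_matching] at ht'
  exact absurd (s.wt_inj ht'.1 ht (ht'.2.trans hw.symm)) hne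

/-- Up to the stage `q`, the special sequence and the sequence of stages look alike. -/
theorem alternating_matched_le (h : ∀ i < n, IsStage γ₀ X M j₀ f i) (s : Special) (γ : Idx)
    {q : ℕ} (hq : q + 1 < n) (hqs : q + 1 < s.len) (hw : s.wt (q + 1) = (f (q + 1)).wt) :
    |∑ i ∈ Finset.range (q + 1), (-1) ^ i * matched s γ (f i)| ≤ 1 := by
  classical
  obtain ⟨-, hpar, hist⟩ := history_eq h s hq hqs hw
  have hA := (h q (by omega)).close
  have hT : IsClose (f q).par {ξ | ∃ i ≤ q, ξ ∈ s.set i} := hpar ▸ s.close q hqs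
  have hsub : ∀ i ≤ q, ∀ ξ ∈ s.set i, ξ ∈ (f i).supp → ξ ∈ (f i).set := by
    intro i hi ξ hξ hξA
    have h1 := Finset.mem_image_of_mem (height (f q).par) hξ
    rw [(hist i hi).2] at h1
    obtain ⟨η, hη, he⟩ := Finset.mem_image.1 h1
    have := hA.eq_of_height_eq ⟨i, hi, (h i (by omega)).isAverage.subset hη⟩ ⟨i, hi, hξA⟩ he
    exact this ▸ hη
  have hval : ∀ i ≤ q, matched s γ (f i) =
      (((f i).set.filter fun ξ => ξ ∈ s.set i ∧ ξ < γ).card : ℝ) / nw (f i).wt := fun i hi => by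
    rw [matched_eq_evTerm (by omega : i < s.len) (hist i hi).1]
    exact (h i (by omega)).isAverage.evTerm_eq s γ (hist i hi).1 (hsub i hi)
  have hnonneg : ∀ i ≤ q, 0 ≤ matched s γ (f i) := fun i hi => by
    rw [hval i hi]
    positivity
  have hle : ∀ i ≤ q, matched s γ (f i) ≤ 1 := fun i hi => by
    rw [hval i hi, div_le_one (cast_nw_pos _), ← (h i (by omega)).isAverage.card_eq]
    exact Nat.cast_le.2 (Finset.card_filter_le _ _)
  have hanti : ∀ i, i + 1 < q + 1 → matched s γ (f (i + 1)) ≤ matched s γ (f i) := by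
    intro i hi
    rcases eq_or_ne (matched s γ (f (i + 1))) 0 with h0 | h0
    · rw [h0]
      exact hnonneg i (by omega)
    · refine (hle (i + 1) (by omega)).trans (le_of_eq ?_)
      rw [hval (i + 1) (by omega)] at h0
      obtain ⟨ξ, hξ⟩ : ((f (i + 1)).set.filter fun ξ => ξ ∈ s.set (i + 1) ∧ ξ < γ).Nonempty := by
        rw [Finset.nonempty_iff_ne_empty]
        intro he
        exact h0 (by rw [he, Finset.card_empty, Nat.cast_zero, zero_div])
      obtain ⟨hξF, hξs, hξγ⟩ := Finset.mem_filter.1 hξ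
      have hξA := (h (i + 1) (by omega)).isAverage.subset hξF
      rw [hval i (by omega), Finset.filter_true_of_mem, (h i (by omega)).isAverage.card_eq,
        div_self (cast_nw_pos _).ne']
      intro η hη
      have hηA := (h i (by omega)).isAverage.subset hη
      have hlt := (h (i + 1) (by omega)).lt i i.lt_add_one η hηA ξ hξA
      refine ⟨?_, hlt.trans hξγ⟩
      have h1 := Finset.mem_image_of_mem (height (f q).par) hη
      rw [← (hist i (by omega)).2] at h1
      obtain ⟨ζ, hζ, he⟩ := Finset.mem_image.1 h1
      have := hA.mem_of_height_eq hT ⟨i + 1, by omega, hξA⟩ ⟨i + 1, by omega, hξs⟩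
        ⟨i, by omega, hηA⟩ hlt ⟨i, by omega, hζ⟩ he
      exact this ▸ hζ
  obtain ⟨h1, h2⟩ := abs_alternating_sum_le (q + 1) (fun i => matched s γ (f i)) 1
    (fun i hi => hnonneg i (by omega)) zero_le_one (fun _ => hle 0 (by omega)) hanti
  rw [abs_of_nonneg h1]
  exact h2

theorem abs_sum_alternating_matched_le (h : ∀ i < n, IsStage γ₀ X M j₀ f i) (hM : 0 ≤ M)
    (hn : n ≤ j₀ + 1) (s : Special) (γ : Idx) :
    |∑ i ∈ Finset.range n, (-1) ^ i * matched s γ (f i)| ≤ 4 * M + 1 := by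
  classical
  have habs : ∀ i, |(-1) ^ i * matched s γ (f i)| = |matched s γ (f i)| := fun i => by
    rw [abs_mul, abs_neg_one_pow, one_mul]
  set D := (Finset.range n).filter fun i => 0 < i ∧ i < s.len ∧ s.wt i = (f i).wt with hD
  have hmemD : ∀ i, i ∈ D ↔ i < n ∧ 0 < i ∧ i < s.len ∧ s.wt i = (f i).wt := fun i => by
    rw [hD, Finset.mem_filter, Finset.mem_range]
  have hzero : ∀ i < n, 0 < i → i ∉ D → s.wt 0 ≠ (f i).wt → matched s γ (f i) = 0 := by
    intro i hi hi0 hiD h0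
    refine matched_eq_zero fun t ht he => ?_
    obtain _ | t := t
    · exact h0 he
    obtain ⟨i, rfl⟩ := Nat.exists_eq_add_of_lt hi0
    simp only [zero_add] at *
    obtain ⟨rfl, -⟩ := history_eq h s hi ht he
    exact hiD ((hmemD _).2 ⟨hi, hi0, ht, he⟩)
  rcases D.eq_empty_or_nonempty with hDe | hDne
  · have hcard : ((Finset.range n).filter fun i => i = 0 ∨ s.wt 0 = (f i).wt).card ≤ 2 := by
      rw [Finset.filter_or]
      refine (Finset.card_union_le _ _).trans (add_le_add (b := 1) (d := 1)
        (Finset.card_le_one.2 fun i hi k hk => ?_) (Finset.card_le_one.2 fun i hi k hk => ?_))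
      · rw [(Finset.mem_filter.1 hi).2, (Finset.mem_filter.1 hk).2]
      · obtain ⟨hi1, hi2⟩ := Finset.mem_filter.1 hi
        obtain ⟨hk1, hk2⟩ := Finset.mem_filter.1 hk
        exact stage_wt_inj h hn (Finset.mem_range.1 hi1) (Finset.mem_range.1 hk1)
          (hi2.symm.trans hk2)
    rw [← Finset.sum_filter_of_ne (p := fun i => i = 0 ∨ s.wt 0 = (f i).wt) fun i hi hne => by
      by_contra! hcon
      refine hne ?_
      rw [hzero i (Finset.mem_range.1 hi) (Nat.pos_of_ne_zero hcon.1)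
        (by rw [hDe]; exact Finset.notMem_empty i) hcon.2, mul_zero]]
    refine (Finset.abs_sum_le_sum_abs _ _).trans ((Finset.sum_le_card_nsmul _ _ (2 * M)
      fun i hi => ?_).trans ?_)
    · rw [habs]
      exact abs_matched_le h hM s γ (Finset.mem_range.1 (Finset.mem_filter.1 hi).1)
    · rw [nsmul_eq_mul]
      have : ((((Finset.range n).filter fun i => i = 0 ∨ s.wt 0 = (f i).wt).card : ℕ) : ℝ) ≤ 2 :=
        by exact_mod_cast hcard
      nlinarith
  · obtain ⟨q, hqD, hqmax⟩ := D.exists_max_image id hDne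
    obtain ⟨hqn, hq0, hqs, hqw⟩ := (hmemD q).1 hqD
    obtain ⟨q, rfl⟩ : ∃ p, q = p + 1 := ⟨q - 1, by omega⟩
    have hw0 : s.wt 0 = (f 0).wt := ((history_eq h s hqn hqs hqw).2.2 0 (Nat.zero_le q)).1
    have htail : ∀ i ∈ Finset.range n, i ∉ Finset.range (q + 2) →
        (-1) ^ i * matched s γ (f i) = 0 := by
      intro i hi hiq
      rw [Finset.mem_range] at hi hiq
      rw [hzero i hi (by omega) (fun hiD => ?_) (fun he => ?_), mul_zero]
      · have : i ≤ q + 1 := hqmax i hiD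
        omega
      · have := stage_wt_inj h hn (by omega : 0 < n) hi (hw0.symm.trans he)
        omega
    rw [← Finset.sum_subset (Finset.range_subset_range.2 (by omega)) htail,
      Finset.sum_range_succ]
    have h1 := alternating_matched_le h s γ hqn hqs hqw
    have h2 := abs_matched_le h hM s γ hqn
    rw [← habs] at h2
    refine (abs_add_le _ _).trans ?_
    linarith

theorem norm_alternating_sum_le (h : ∀ i < n, IsStage γ₀ X M j₀ f i) (hM : 0 ≤ M)
    (hn : n ≤ j₀ + 1) : ‖∑ i ∈ Finset.range n, (-1 : ℝ) ^ i • (f i).vec‖ ≤ 12 * M + 1 := by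
  refine norm_le_of_abs_ev_le (by positivity) fun s γ => ?_
  have h1 : |∑ i ∈ Finset.range n, (-1) ^ i * (ev s γ (f i).vec - matched s γ (f i))| ≤
      8 * M := by
    refine (Finset.abs_sum_le_sum_abs _ _).trans ((Finset.sum_le_sum
      (g := fun i => 4 * M * (1 / 2 : ℝ) ^ (f i).wt) fun i hi => ?_).trans ?_)
    · rw [abs_mul, abs_neg_one_pow, one_mul]
      exact (h i (Finset.mem_range.1 hi)).isAverage.abs_ev_sub_le s γ
    · rw [← Finset.mul_sum]
      have := sum_two_inv_pow_stage_wt_le h hn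
      nlinarith
  have h2 := abs_sum_alternating_matched_le h hM hn s γ
  have h3 : ev s γ (∑ i ∈ Finset.range n, (-1 : ℝ) ^ i • (f i).vec) =
      ∑ i ∈ Finset.range n, (-1) ^ i * (ev s γ (f i).vec - matched s γ (f i)) +
        ∑ i ∈ Finset.range n, (-1) ^ i * matched s γ (f i) := by
    rw [map_sum, ← Finset.sum_add_distrib]
    exact Finset.sum_congr rfl fun i _ => by
      rw [map_smul, smul_eq_mul]
      ring
  rw [h3]
  refine (abs_add_le _ _).trans ?_
  linarith

theorem norm_sum_vec_sub_approx_le (h : ∀ i < n, IsStage γ₀ X M j₀ f i) (hn : n ≤ j₀ + 1)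
    {K : Finset ℕ} (hK : K ⊆ Finset.range n) (c : ℕ → ℝ) (hc : ∀ i, |c i| ≤ 1) :
    ‖∑ i ∈ K, c i • (f i).vec - ∑ i ∈ K, c i • (f i).approx‖ ≤ 2 := by
  rw [← Finset.sum_sub_distrib]
  refine (norm_sum_le _ _).trans (le_trans ?_ (sum_two_inv_pow_stage_wt_le h hn))
  refine (Finset.sum_le_sum fun i hi => ?_).trans
    (Finset.sum_le_sum_of_subset_of_nonneg hK fun _ _ _ => by positivity)
  rw [← smul_sub, norm_smul, Real.norm_eq_abs]
  exact (mul_le_of_le_one_left (norm_nonneg _) (hc i)).trans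
    (h i (Finset.mem_range.1 (hK hi))).norm_sub_le

end Alternating

/-! ### Decompositions -/

theorem exists_forall_norm_le_norm_sub {E : Type*} [NormedAddCommGroup E] [NormedSpace ℝ E]
    [CompleteSpace E] {X₀ X₁ : Submodule ℝ E} (h₀ : IsClosed (X₀ : Set E))
    (h₁ : IsClosed (X₁ : Set E)) (hinf : X₀ ⊓ X₁ = ⊥)
    (hsup : IsClosed ((X₀ ⊔ X₁ : Submodule ℝ E) : Set E)) :
    ∃ C : ℝ, 0 ≤ C ∧ ∀ x ∈ X₀, ∀ y ∈ X₁, ‖x‖ ≤ C * ‖x - y‖ := by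
  have := h₀.completeSpace_coe
  have := h₁.completeSpace_coe
  let T : X₀ × X₁ →L[ℝ] E := X₀.subtypeL.coprod X₁.subtypeL
  have hT : ∀ p, T p = p.1 + p.2 := fun _ => rfl
  have hinj : Function.Injective T := by
    rw [injective_iff_map_eq_zero]
    rintro ⟨x, y⟩ hxy
    have hxy' : (x : E) = -y := eq_neg_of_add_eq_zero_left hxy
    have hx : (x : E) ∈ X₀ ⊓ X₁ := ⟨x.2, hxy' ▸ X₁.neg_mem y.2⟩
    rw [hinf, Submodule.mem_bot] at hx
    have hy : (y : E) = 0 := by rw [hx] at hxy'; exact neg_eq_zero.1 hxy'.symm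
    exact Prod.ext (Subtype.ext hx) (Subtype.ext hy)
  have hrange : range T = ((X₀ ⊔ X₁ : Submodule ℝ E) : Set E) := by
    ext z
    simp only [mem_range, SetLike.mem_coe, Submodule.mem_sup, Prod.exists, hT]
    constructor
    · rintro ⟨x, y, rfl⟩
      exact ⟨x, x.2, y, y.2, rfl⟩
    · rintro ⟨x, hx, y, hy, rfl⟩
      exact ⟨⟨x, hx⟩, ⟨y, hy⟩, rfl⟩
  obtain ⟨C, hC⟩ := T.antilipschitz_of_injective_of_isClosed_range hinj (hrange ▸ hsup)
  refine ⟨C, C.2, fun x hx y hy => ?_⟩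
  have h1 := hC.le_mul_dist (⟨x, hx⟩, ⟨-y, X₁.neg_mem hy⟩) 0
  rw [dist_zero_right, map_zero, dist_zero_right, hT, ← sub_eq_add_neg] at h1
  exact (norm_fst_le ((⟨x, hx⟩, ⟨-y, X₁.neg_mem hy⟩) : X₀ × X₁)).trans h1

/-- Two nonseparable subspaces have vectors which are arbitrarily close relative to their norm. -/
theorem exists_norm_sub_le {X₀ X₁ : Submodule ℝ Space}
    (h₀ : ¬ TopologicalSpace.IsSeparable (X₀ : Set Space))
    (h₁ : ¬ TopologicalSpace.IsSeparable (X₁ : Set Space)) :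
    ∃ B : ℝ, ∀ N : ℕ, ∃ x ∈ X₀, ∃ y ∈ X₁, (N : ℝ) ≤ ‖x‖ ∧ ‖x - y‖ ≤ B := by
  classical
  obtain ⟨M₀, hM₀, hb₀⟩ := exists_isBlock h₀
  obtain ⟨M₁, hM₁, hb₁⟩ := exists_isBlock h₁
  set M := max M₀ M₁ with hM
  have hM0 : 0 ≤ M := hM₀.trans (le_max_left _ _)
  obtain ⟨γ₀, hγ₀⟩ := exists_isSeparated (fun b : Bool => cond b X₀ X₁) (M := M)
    (fun b γ δ hδ => by
      cases b
      · obtain ⟨u, a, α, h, ha⟩ := hb₁ γ δ hδ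
        exact ⟨u, a, α, h.mono (le_max_right _ _), ha⟩
      · obtain ⟨u, a, α, h, ha⟩ := hb₀ γ δ hδ
        exact ⟨u, a, α, h.mono (le_max_left _ _), ha⟩)
    (fun j => (1 / 2) ^ j / mw j) fun j => div_pos (by positivity) (mw_pos j)
  refine ⟨12 * M + 1 + 2, fun N => ?_⟩
  set n := 2 * (N + 2) with hn
  obtain ⟨f, hf⟩ := exists_isStage (X := fun k => cond (decide (Even k)) X₀ X₁)
    (fun j k => hγ₀ j (decide (Even k))) n n
  have hn1 : n ≤ n + 1 := n.le_succ
  set K := (Finset.range n).filter fun i => Even i with hK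
  set K' := (Finset.range n).filter fun i => ¬ Even i with hK'
  have hKs : K ⊆ Finset.range n := Finset.filter_subset _ _
  have hcard : N + 2 ≤ K.card := by
    have hsub : (Finset.range (N + 2)).image (fun i => 2 * i) ⊆ K := fun i hi => by
      obtain ⟨l, hl, rfl⟩ := Finset.mem_image.1 hi
      rw [Finset.mem_range] at hl
      exact Finset.mem_filter.2 ⟨Finset.mem_range.2 (by omega), even_two_mul l⟩
    have := Finset.card_le_card hsub
    rwa [Finset.card_image_of_injective _ (mul_right_injective₀ two_ne_zero),
      Finset.card_range] at this
  have hsplit : ∑ i ∈ Finset.range n, (-1 : ℝ) ^ i • (f i).approx =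
      ∑ i ∈ K, (f i).approx - ∑ i ∈ K', (f i).approx := by
    rw [← Finset.sum_filter_add_sum_filter_not _ (fun i => Even i), sub_eq_add_neg,
      ← Finset.sum_neg_distrib]
    refine congrArg₂ _ (Finset.sum_congr rfl fun i hi => ?_) (Finset.sum_congr rfl fun i hi => ?_)
    · rw [(Finset.mem_filter.1 hi).2.neg_one_pow, one_smul]
    · rw [(Nat.not_even_iff_odd.1 (Finset.mem_filter.1 hi).2).neg_one_pow, neg_smul, one_smul]
  refine ⟨∑ i ∈ K, (f i).approx, X₀.sum_mem fun i hi => ?_, ∑ i ∈ K', (f i).approx,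
    X₁.sum_mem fun i hi => ?_, ?_, ?_⟩
  · obtain ⟨h1, h2⟩ := Finset.mem_filter.1 hi
    have := (hf i (Finset.mem_range.1 h1)).mem
    rwa [decide_eq_true h2] at this
  · obtain ⟨h1, h2⟩ := Finset.mem_filter.1 hi
    have := (hf i (Finset.mem_range.1 h1)).mem
    rwa [decide_eq_false h2] at this
  · have h1 := card_le_norm_sum hf hn1 hKs
    have h2 := norm_sum_vec_sub_approx_le hf hn1 hKs (fun _ => 1) fun _ => by simp
    simp only [one_smul] at h2
    have h3 := norm_sub_norm_le (∑ i ∈ K, (f i).vec) (∑ i ∈ K, (f i).approx)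
    have h4 : (N : ℝ) + 2 ≤ K.card := by exact_mod_cast hcard
    linarith
  · rw [← hsplit]
    have h1 := norm_alternating_sum_le hf hM0 hn1
    have h2 := norm_sum_vec_sub_approx_le hf hn1 (Finset.Subset.refl _) (fun i => (-1) ^ i)
      fun i => by rw [abs_neg_one_pow]
    have h3 := norm_sub_norm_le (∑ i ∈ Finset.range n, (-1 : ℝ) ^ i • (f i).approx)
      (∑ i ∈ Finset.range n, (-1 : ℝ) ^ i • (f i).vec)
    rw [norm_sub_rev] at h3
    linarith

theorem isSeparable_or_isSeparable {Y X₀ X₁ : Submodule ℝ Space} (hY : IsClosed (Y : Set Space))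
    (h₀ : IsClosed (X₀ : Set Space)) (h₁ : IsClosed (X₁ : Set Space)) (hinf : X₀ ⊓ X₁ = ⊥)
    (hsup : X₀ ⊔ X₁ = Y) :
    TopologicalSpace.IsSeparable (X₀ : Set Space) ∨
      TopologicalSpace.IsSeparable (X₁ : Set Space) := by
  by_contra! hcon
  obtain ⟨B, hB⟩ := exists_norm_sub_le hcon.1 hcon.2
  obtain ⟨C, hC0, hC⟩ := exists_forall_norm_le_norm_sub h₀ h₁ hinf (hsup ▸ hY)
  obtain ⟨N, hN⟩ := exists_nat_gt (C * B)
  obtain ⟨x, hx, y, hy, hNx, hxy⟩ := hB N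
  have h2 := hC x hx y hy
  have h3 := mul_le_mul_of_nonneg_left hxy hC0
  linarith

end LopezAbadTodorcevic

/-- There exists a nonseparable `c₀`-saturated Banach space in which, for every closed
decomposition of a closed subspace, one of the summands is separable. -/
theorem exists_c0_saturated_nonseparable_space_with_separable_decompositions :
    Nonempty LopezAbadTodorcevicSpace := by
  exact ⟨{
    X := LopezAbadTodorcevic.Space
    complete := inferInstance
    nonseparable := LopezAbadTodorcevic.not_separableSpace
    c0_saturated := LopezAbadTodorcevic.exists_czero_subspace
    decomposition_separable := fun _ _ _ hY h₀ h₁ _ _ hinf hsup =>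
      LopezAbadTodorcevic.isSeparable_or_isSeparable hY h₀ h₁ hinf hsup }⟩
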